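/- For every pair of integers h, t with 1 ≤ h < t there exist a constant c > 0 and N ∈ ℕ such that for every multiple n of t with n ≥ N the following holds: every polyhedron Q ⊆ ℝ^{E(K_n)} satisfying TSP_n ⊆ Q and such that every (h,t)-uniform comb inequality x(δ(H)) + Σ_{i=1}^{k} x(δ(T_i)) ≥ 3k+1 is valid for all points of Q, has extension complexity xc(Q) ≥ 2^{c·n/t}. -/

import Mathlib

open SimpleGraph Finset

attribute [local instance] Classical.propDecidable

/-- The edge set of the complete graph `K_n`: non-diagonal unordered pairs. -/
abbrev KEdge (n : ℕ) := {e : Sym2 (Fin n) // ¬ e.IsDiag}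

/-- An edge `e` crosses the vertex set `S` if it has an endpoint in `S`
and an endpoint outside `S`. -/
def crossing {V : Type*} (S : Finset V) (e : Sym2 V) : Prop :=
  (∃ a ∈ e, a ∈ S) ∧ (∃ a ∈ e, a ∉ S)

/-- `x(δ(S))`: the sum of the coordinates of `x` over the edges of `K_n`
crossing `S`. -/
noncomputable def cutSum {n : ℕ} (S : Finset (Fin n)) (x : KEdge n → ℝ) : ℝ :=
  ∑ e ∈ Finset.univ.filter (fun e : KEdge n => crossing S e.1), x e

/-- A comb with handle `H` and teeth `T 0, …, T (k-1)`. -/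
def IsComb {V : Type*} [Fintype V] [DecidableEq V]
    (H : Finset V) {k : ℕ} (T : Fin k → Finset V) : Prop :=
  3 ≤ k ∧ Odd k ∧
  (∀ i j, i ≠ j → Disjoint (T i) (T j)) ∧
  (∀ i, (H ∩ T i).Nonempty) ∧
  (H \ Finset.univ.biUnion T).Nonempty

/-- An `(h,t)`-uniform comb: every tooth has size `t` and meets the handle
in exactly `h` vertices. -/
def IsUniformComb {V : Type*} [Fintype V] [DecidableEq V] (h t : ℕ)
    (H : Finset V) {k : ℕ} (T : Fin k → Finset V) : Prop :=
  IsComb H T ∧ ∀ i, (T i).card = t ∧ (H ∩ T i).card = h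

/-- The extension complexity of `P ⊆ ℝ^ι`: the least number of facets
(inequalities) of a polyhedron `{x : Ax ≤ b}` projecting linearly onto `P`. -/
noncomputable def xc {ι : Type*} [Fintype ι] (P : Set (ι → ℝ)) : ℕ :=
  sInf {k | ∃ (m : ℕ) (A : Matrix (Fin k) (Fin m) ℝ) (b : Fin k → ℝ)
      (π : (Fin m → ℝ) →ₗ[ℝ] (ι → ℝ)),
      π '' {x | A.mulVec x ≤ b} = P}


/-- `P` is a polyhedron if it is the solution set of a finite system of
linear inequalities. -/
def IsPolyhedron {ι : Type*} [Fintype ι] (P : Set (ι → ℝ)) : Prop :=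
  ∃ (k : ℕ) (A : Fin k → ι → ℝ) (b : Fin k → ℝ),
    P = {x | ∀ i, ∑ j, A i j * x j ≤ b i}

/-- The TSP polytope: the convex hull of the characteristic vectors of the
edge sets of the Hamiltonian cycles (tours) of `K_n`. -/
noncomputable def tspPolytope (n : ℕ) : Set (KEdge n → ℝ) :=
  convexHull ℝ {x | ∃ (v : Fin n) (C : (⊤ : SimpleGraph (Fin n)).Walk v v),
    C.IsHamiltonianCycle ∧ x = fun e => if e.1 ∈ C.edges then (1 : ℝ) else 0}


/-! ### Part 1: a Chernoff-type inequality on the cube -/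

/-- The sign of a bit. -/
noncomputable def bsgn (b : Bool) : ℝ := if b = true then 1 else -1

theorem sum_exp_cube {ι : Type*} [Fintype ι] [DecidableEq ι] (s : ι → ℝ)
    (hs : ∀ r, s r = 1 ∨ s r = -1) (ε : ℝ) :
    ∑ z : ι → Bool, Real.exp (ε * ∑ r, s r * bsgn (z r)) ≤
      2 ^ (Fintype.card ι) * Real.exp (ε ^ 2 / 2 * Fintype.card ι) := by
  have h1 : ∀ z : ι → Bool, Real.exp (ε * ∑ r, s r * bsgn (z r)) =
      ∏ r, Real.exp (ε * (s r * bsgn (z r))) := by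
    intro z
    rw [Finset.mul_sum, Real.exp_sum]
  simp_rw [h1]
  have h2 := Fintype.prod_sum (fun (r : ι) (b : Bool) => Real.exp (ε * (s r * bsgn b)))
  have h3 : ∑ z : ι → Bool, ∏ r, Real.exp (ε * (s r * bsgn (z r))) =
      ∏ r, ∑ b, Real.exp (ε * (s r * bsgn b)) := by
    rw [h2]
  rw [h3]
  have h4 : ∀ r ∈ (Finset.univ : Finset ι), ∑ b, Real.exp (ε * (s r * bsgn b)) ≤
      2 * Real.exp (ε ^ 2 / 2) := by
    intro r _
    have hc := Real.cosh_le_exp_half_sq ε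
    rw [Real.cosh_eq] at hc
    rcases hs r with h | h <;> simp [h, bsgn] <;> linarith
  calc ∏ r, ∑ b, Real.exp (ε * (s r * bsgn b)) ≤ ∏ r : ι, (2 * Real.exp (ε ^ 2 / 2)) :=
        Finset.prod_le_prod (fun r _ => Finset.sum_nonneg fun _ _ => (Real.exp_pos _).le) h4
    _ = _ := by
        rw [Finset.prod_const, mul_pow, ← Real.exp_nat_mul, Finset.card_univ]
        ring_nf

theorem cube_bias {ι : Type*} [Fintype ι] [DecidableEq ι] (F : (ι → Bool) → ℝ) (B ε : ℝ)
    (hF : ∀ z, 0 ≤ F z) (hB : ∀ z, F z ≤ B) (hε : 0 < ε) :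
    ∑ r, |∑ z, bsgn (z r) * F z| ≤
      Fintype.card ι * (ε * ∑ z, F z +
        B * (2 ^ (Fintype.card ι) * Real.exp (-(ε ^ 2 / 2 * Fintype.card ι)))) := by
  set N := Fintype.card ι with hN
  have hB0 : 0 ≤ B := (hF (fun _ => true)).trans (hB _)
  have hsig : ∀ r : ι, ∃ t : ℝ, (t = 1 ∨ t = -1) ∧
      |∑ z, bsgn (z r) * F z| = t * ∑ z, bsgn (z r) * F z := by
    intro r
    rcases abs_choice (∑ z, bsgn (z r) * F z) with h | h
    · exact ⟨1, Or.inl rfl, by rw [h]; ring⟩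
    · exact ⟨-1, Or.inr rfl, by rw [h]; ring⟩
  choose s hs hs' using hsig
  have e1 : ∑ r, |∑ z, bsgn (z r) * F z| = ∑ z, F z * ∑ r, s r * bsgn (z r) := by
    simp_rw [hs', Finset.mul_sum]
    rw [Finset.sum_comm]
    refine Finset.sum_congr rfl fun z _ => Finset.sum_congr rfl fun r _ => by ring
  rw [e1]
  have hL : ∀ z : ι → Bool, ∑ r, s r * bsgn (z r) ≤ N := by
    intro z
    calc ∑ r, s r * bsgn (z r) ≤ ∑ r : ι, (1 : ℝ) := by
          refine Finset.sum_le_sum fun r _ => ?_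
          rcases hs r with h | h <;> cases hz : z r <;> simp [h, bsgn]
      _ = N := by simp [hN]
  have hp : ∀ z : ι → Bool, F z * ∑ r, s r * bsgn (z r) ≤
      N * (ε * F z + B * (Real.exp (-(ε ^ 2 * N)) *
        Real.exp (ε * ∑ r, s r * bsgn (z r)))) := by
    intro z
    set L := ∑ r, s r * bsgn (z r) with hLd
    have hE : 0 < Real.exp (-(ε ^ 2 * N)) * Real.exp (ε * L) := by positivity
    have hNn : (0 : ℝ) ≤ N := Nat.cast_nonneg _
    by_cases hc : L ≤ ε * N
    · have : F z * L ≤ F z * (ε * N) := mul_le_mul_of_nonneg_left hc (hF z)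
      have : 0 ≤ N * (B * (Real.exp (-(ε ^ 2 * N)) * Real.exp (ε * L))) := by positivity
      nlinarith
    · push Not at hc
      have h1 : (1 : ℝ) ≤ Real.exp (-(ε ^ 2 * N)) * Real.exp (ε * L) := by
        rw [← Real.exp_add]
        apply Real.one_le_exp
        nlinarith
      have h2 : F z * L ≤ B * N := by
        have hL0 : 0 ≤ L := le_trans (by positivity) hc.le
        exact mul_le_mul (hB z) (hL z) hL0 hB0
      have h3 : B * N ≤ N * (B * (Real.exp (-(ε ^ 2 * N)) * Real.exp (ε * L))) := by
        have : B * N * 1 ≤ B * N * (Real.exp (-(ε ^ 2 * N)) * Real.exp (ε * L)) :=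
          mul_le_mul_of_nonneg_left h1 (by positivity)
        nlinarith
      have h4 : 0 ≤ N * (ε * F z) := by have := hF z; positivity
      nlinarith
  refine (Finset.sum_le_sum fun z _ => hp z).trans ?_
  rw [← Finset.mul_sum, Finset.sum_add_distrib, ← Finset.mul_sum, ← Finset.mul_sum,
    ← Finset.mul_sum]
  have hexp := sum_exp_cube s hs ε
  have hNn : (0 : ℝ) ≤ N := Nat.cast_nonneg _
  refine mul_le_mul_of_nonneg_left ?_ hNn
  refine add_le_add le_rfl (mul_le_mul_of_nonneg_left ?_ hB0)
  calc _ ≤ Real.exp (-(ε ^ 2 * N)) * (2 ^ N * Real.exp (ε ^ 2 / 2 * N)) :=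
        mul_le_mul_of_nonneg_left hexp (Real.exp_pos _).le
    _ = 2 ^ N * (Real.exp (-(ε ^ 2 * N)) * Real.exp (ε ^ 2 / 2 * N)) := by ring
    _ = _ := by rw [← Real.exp_add]; ring_nf
    _ ≤ _ := le_rfl

/-- Averaging over a group of symmetries. -/
theorem view_bound {G ι : Type*} [Group G] [Fintype G] [Fintype ι] [DecidableEq ι] (o : ι)
    (τ : ι → G) (K : G → ℝ) (F : G → (ι → Bool) → ℝ) (B ε : ℝ) (hε : 0 < ε)
    (hK : ∀ g, 0 ≤ K g) (hF : ∀ g z, 0 ≤ F g z) (hB : ∀ g z, F g z ≤ B)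
    (hKτ : ∀ g r, K (g * τ r) = K g)
    (hFτ : ∀ g r z, F (g * τ r) z = F g (z ∘ Equiv.swap o r)) :
    ∑ g, K g * |∑ z, bsgn (z o) * F g z| ≤
      ε * ∑ g, K g * ∑ z, F g z +
        B * (2 ^ (Fintype.card ι) * Real.exp (-(ε ^ 2 / 2 * Fintype.card ι))) * ∑ g, K g := by
  have hNpos : (0 : ℝ) < Fintype.card ι := by
    have : 0 < Fintype.card ι := Fintype.card_pos_iff.2 ⟨o⟩
    exact_mod_cast this
  have h1 : ∀ r : ι, ∑ g, K g * |∑ z, bsgn (z o) * F g z| =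
      ∑ g, K g * |∑ z, bsgn (z r) * F g z| := by
    intro r
    rw [← Equiv.sum_comp (Equiv.mulRight (τ r))]
    refine Finset.sum_congr rfl fun g _ => ?_
    simp only [Equiv.coe_mulRight, hKτ, hFτ]
    congr 2
    rw [← Equiv.sum_comp (Equiv.arrowCongr (Equiv.swap o r) (Equiv.refl Bool))]
    refine Finset.sum_congr rfl fun z _ => ?_
    have : ((Equiv.arrowCongr (Equiv.swap o r) (Equiv.refl Bool)) z) ∘ Equiv.swap o r = z := by
      ext i; simp [Equiv.arrowCongr]
    rw [this]
    simp [Equiv.arrowCongr]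
  have h2 : (Fintype.card ι : ℝ) * ∑ g, K g * |∑ z, bsgn (z o) * F g z| =
      ∑ g, K g * ∑ r, |∑ z, bsgn (z r) * F g z| := by
    have e1 : (Fintype.card ι : ℝ) * ∑ g, K g * |∑ z, bsgn (z o) * F g z| =
        ∑ _r : ι, ∑ g, K g * |∑ z, bsgn (z o) * F g z| := by simp
    rw [e1, Finset.sum_congr rfl (fun r _ => h1 r), Finset.sum_comm]
    exact Finset.sum_congr rfl fun g _ => (Finset.mul_sum _ _ _).symm
  have h3 : ∑ g, K g * ∑ r, |∑ z, bsgn (z r) * F g z| ≤ ∑ g, K g * (Fintype.card ι *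
      (ε * ∑ z, F g z +
        B * (2 ^ (Fintype.card ι) * Real.exp (-(ε ^ 2 / 2 * Fintype.card ι))))) :=
    Finset.sum_le_sum fun g _ => mul_le_mul_of_nonneg_left
      (cube_bias (F g) B ε (hF g) (hB g) hε) (hK g)
  rw [← h2] at h3
  have h4 : ∑ g, K g * (Fintype.card ι * (ε * ∑ z, F g z +
        B * (2 ^ (Fintype.card ι) * Real.exp (-(ε ^ 2 / 2 * Fintype.card ι))))) =
      Fintype.card ι * (ε * ∑ g, K g * ∑ z, F g z +
        B * (2 ^ (Fintype.card ι) * Real.exp (-(ε ^ 2 / 2 * Fintype.card ι))) * ∑ g, K g) := by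
    rw [mul_add, Finset.mul_sum, Finset.mul_sum, Finset.mul_sum, Finset.mul_sum,
      ← Finset.sum_add_distrib]
    refine Finset.sum_congr rfl fun g _ => by ring
  rw [h4] at h3
  exact le_of_mul_le_mul_left h3 hNpos

/-! ### Part 2: the vertex structure of the random partition -/

/-- Vertices: pairs `a`, quadruples `b`, and the ten special vertices. -/
abbrev Vx (m : ℕ) := (Fin m × Bool) ⊕ ((Fin m × Bool × Bool) ⊕ (Fin 5 × Bool))

/-- The matching on the ten special vertices. -/
def Cfun (b : Bool) (j : Fin 5) (w : Bool) : Fin 5 × Bool :=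
  match b, j with
  | false, 0 => (1, w)
  | false, 1 => (0, w)
  | _, j => (j, !w)

/-- The matching with pattern `y`. -/
def Mfun {m : ℕ} (y : Option (Fin m) → Bool) : Vx m → Vx m
  | Sum.inl (r, s) => Sum.inl (r, !s)
  | Sum.inr (Sum.inl (r, s, s')) => Sum.inr (Sum.inl (r, s ^^ !(y (some r)), s' ^^ y (some r)))
  | Sum.inr (Sum.inr (j, w)) => Sum.inr (Sum.inr (Cfun (y none) j w))

/-- Membership of special vertices in the odd set. -/
def Cmem (b : Bool) (j : Fin 5) (w : Bool) : Bool :=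
  match w, j with
  | true, _ => false
  | false, 0 => b
  | false, 1 => b
  | false, _ => true

/-- The odd set with pattern `z`. -/
def Umem {m : ℕ} (z : Option (Fin m) → Bool) : Vx m → Bool
  | Sum.inl (r, _) => z (some r)
  | Sum.inr (Sum.inl _) => false
  | Sum.inr (Sum.inr (j, w)) => Cmem (z none) j w

theorem Cfun_invol (b : Bool) (j : Fin 5) (w : Bool) :
    Cfun b (Cfun b j w).1 (Cfun b j w).2 = (j, w) := by
  cases b <;> fin_cases j <;> cases w <;> rfl

theorem Mfun_invol {m : ℕ} (y : Option (Fin m) → Bool) : Function.Involutive (Mfun y) := by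
  rintro (⟨r, s⟩ | ⟨r, s, s'⟩ | ⟨j, w⟩)
  · simp [Mfun]
  · cases h : y (some r) <;> simp [Mfun, h]
  · simp [Mfun, Cfun_invol]

theorem Mfun_ne {m : ℕ} (y : Option (Fin m) → Bool) (v : Vx m) : Mfun y v ≠ v := by
  rcases v with (⟨r, s⟩ | ⟨r, s, s'⟩ | ⟨j, w⟩)
  · simp [Mfun]
  · cases h : y (some r) <;> simp [Mfun, h]
  · cases h : y none <;> fin_cases j <;> cases w <;> simp [Mfun, h, Cfun]

/-- The matching as a permutation. -/
def Mperm {m : ℕ} (y : Option (Fin m) → Bool) : Equiv.Perm (Vx m) := (Mfun_invol y).toPerm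

theorem Mperm_apply {m : ℕ} (y : Option (Fin m) → Bool) (v : Vx m) : Mperm y v = Mfun y v := rfl

/-- The odd set. -/
noncomputable def Uset {m : ℕ} (z : Option (Fin m) → Bool) : Finset (Vx m) :=
  Finset.univ.filter (fun v => Umem z v = true)

theorem mem_Uset {m : ℕ} (z : Option (Fin m) → Bool) (v : Vx m) :
    v ∈ Uset z ↔ Umem z v = true := by simp [Uset]

/-- swap of an `a` pair with `c 0, c 1`. -/
noncomputable def tAfun {m : ℕ} (r : Fin m) : Vx m → Vx m
  | Sum.inl (r', s) => if r' = r then Sum.inr (Sum.inr (cond s 1 0, false)) else Sum.inl (r', s)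
  | Sum.inr (Sum.inl x) => Sum.inr (Sum.inl x)
  | Sum.inr (Sum.inr (j, w)) =>
    match w, j with
    | false, 0 => Sum.inl (r, false)
    | false, 1 => Sum.inl (r, true)
    | w, j => Sum.inr (Sum.inr (j, w))

/-- swap of a `b` quadruple with `c 0, c 1, d 0, d 1`. -/
noncomputable def tBfun {m : ℕ} (r : Fin m) : Vx m → Vx m
  | Sum.inl x => Sum.inl x
  | Sum.inr (Sum.inl (r', s, s')) =>
    if r' = r then Sum.inr (Sum.inr (cond s 1 0, s')) else Sum.inr (Sum.inl (r', s, s'))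
  | Sum.inr (Sum.inr (j, w)) =>
    match j with
    | 0 => Sum.inr (Sum.inl (r, false, w))
    | 1 => Sum.inr (Sum.inl (r, true, w))
    | j => Sum.inr (Sum.inr (j, w))

theorem tAfun_invol {m : ℕ} (r : Fin m) : Function.Involutive (tAfun r) := by
  rintro (⟨r', s⟩ | ⟨r', s, s'⟩ | ⟨j, w⟩)
  · by_cases h : r' = r
    · subst h; cases s <;> simp [tAfun]
    · simp [tAfun, h]
  · simp [tAfun]
  · fin_cases j <;> cases w <;> simp [tAfun]

theorem tBfun_invol {m : ℕ} (r : Fin m) : Function.Involutive (tBfun r) := by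
  rintro (⟨r', s⟩ | ⟨r', s, s'⟩ | ⟨j, w⟩)
  · simp [tBfun]
  · by_cases h : r' = r
    · subst h; cases s <;> simp [tBfun]
    · simp [tBfun, h]
  · fin_cases j <;> cases w <;> simp [tBfun]

/-- The symmetries for the odd-set view. -/
noncomputable def tauA {m : ℕ} : Option (Fin m) → Equiv.Perm (Vx m)
  | none => 1
  | some r => (tAfun_invol r).toPerm

/-- The symmetries for the matching view. -/
noncomputable def tauB {m : ℕ} : Option (Fin m) → Equiv.Perm (Vx m)
  | none => 1
  | some r => (tBfun_invol r).toPerm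

theorem tAfun_M {m : ℕ} (r : Fin m) (y : Option (Fin m) → Bool) (hy : y none = false)
    (v : Vx m) : tAfun r (Mfun y (tAfun r v)) = Mfun y v := by
  rcases v with (⟨r', s⟩ | ⟨r', s, s'⟩ | ⟨j, w⟩)
  · by_cases h : r' = r
    · subst h; cases s <;> simp [tAfun, Mfun, hy, Cfun]
    · simp [tAfun, h, Mfun]
  · simp [tAfun, Mfun]
  · fin_cases j <;> cases w <;> simp [tAfun, Mfun, hy, Cfun]

theorem tAfun_U {m : ℕ} (r : Fin m) (z : Option (Fin m) → Bool)
    (v : Vx m) : Umem z (tAfun r v) = Umem (z ∘ Equiv.swap none (some r)) v := by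
  rcases v with (⟨r', s⟩ | ⟨r', s, s'⟩ | ⟨j, w⟩)
  · by_cases h : r' = r
    · subst h; cases s <;> simp [tAfun, Umem, Cmem]
    · have : Equiv.swap none (some r) (some r') = some r' :=
        Equiv.swap_apply_of_ne_of_ne (by simp) (by simpa using h)
      simp [tAfun, h, Umem, this]
  · simp [tAfun, Umem]
  · fin_cases j <;> cases w <;> simp [tAfun, Umem, Cmem]

theorem tBfun_U {m : ℕ} (r : Fin m) (z : Option (Fin m) → Bool) (hz : z none = false)
    (v : Vx m) : Umem z (tBfun r v) = Umem z v := by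
  rcases v with (⟨r', s⟩ | ⟨r', s, s'⟩ | ⟨j, w⟩)
  · simp [tBfun, Umem]
  · by_cases h : r' = r
    · subst h; cases s <;> cases s' <;> simp [tBfun, Umem, Cmem, hz]
    · simp [tBfun, h, Umem]
  · fin_cases j <;> cases w <;> simp [tBfun, Umem, Cmem, hz]

theorem tBfun_M {m : ℕ} (r : Fin m) (y : Option (Fin m) → Bool)
    (v : Vx m) : tBfun r (Mfun y (tBfun r v)) = Mfun (y ∘ Equiv.swap none (some r)) v := by
  rcases v with (⟨r', s⟩ | ⟨r', s, s'⟩ | ⟨j, w⟩)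
  · simp [tBfun, Mfun]
  · by_cases h : r' = r
    · subst h
      cases hy : y none <;> cases s <;> cases s' <;> simp [tBfun, Mfun, hy, Cfun]
    · have : Equiv.swap none (some r) (some r') = some r' :=
        Equiv.swap_apply_of_ne_of_ne (by simp) (by simpa using h)
      simp [tBfun, h, Mfun, this]
  · cases hy : y (some r) <;> fin_cases j <;> cases w <;> simp [tBfun, Mfun, Cfun, hy]

/-- The rotation of the special vertices. -/
def rot (m : ℕ) (i : Fin 5) : Equiv.Perm (Vx m) :=
  Equiv.sumCongr (Equiv.refl _) (Equiv.sumCongr (Equiv.refl _)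
    (Equiv.prodCongr (Equiv.addLeft i) (Equiv.refl _)))

theorem rot_mul (m : ℕ) (i j : Fin 5) : rot m i * rot m j = rot m (i + j) := by
  ext v
  rcases v with (⟨r', s⟩ | ⟨r', s, s'⟩ | ⟨j, w⟩) <;> simp [rot, add_assoc]

theorem Cmem_true (j : Fin 5) (w : Bool) : Cmem true j w = !w := by
  fin_cases j <;> cases w <;> rfl

theorem Cfun_true (j : Fin 5) (w : Bool) : Cfun true j w = (j, !w) := by
  fin_cases j <;> cases w <;> rfl

theorem rot_U {m : ℕ} (i : Fin 5) (z : Option (Fin m) → Bool) (hz : z none = true)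
    (v : Vx m) : Umem z (rot m i v) = Umem z v := by
  rcases v with (⟨r', s⟩ | ⟨r', s, s'⟩ | ⟨j, w⟩) <;> simp [rot, Umem, hz, Cmem_true]

theorem rot_M {m : ℕ} (i : Fin 5) (y : Option (Fin m) → Bool) (hy : y none = true)
    (v : Vx m) : rot m i (Mfun y v) = Mfun y (rot m i v) := by
  rcases v with (⟨r', s⟩ | ⟨r', s, s'⟩ | ⟨j, w⟩) <;> simp [rot, Mfun, hy, Cfun_true]

/-- The number of matching edges cut by `U`. -/
noncomputable def cutN {V : Type*} (U : Finset V) (f : Equiv.Perm V) : ℕ :=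
  (U.filter (fun v => f v ∉ U)).card

theorem cutN_conj {V : Type*} (U : Finset V) (f σ : Equiv.Perm V) :
    cutN (U.map σ.toEmbedding) (σ * f * σ⁻¹) = cutN U f := by
  unfold cutN
  rw [← Finset.card_map σ.toEmbedding (s := U.filter (fun v => f v ∉ U))]
  congr 1
  ext v
  simp only [Finset.mem_filter, Finset.mem_map_equiv, Equiv.Perm.mul_apply]
  simp [Equiv.Perm.inv_def]

theorem finmap_mul {V : Type*} (U : Finset V) (σ τ : Equiv.Perm V) :
    U.map (σ * τ).toEmbedding = (U.map τ.toEmbedding).map σ.toEmbedding := by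
  rw [Finset.map_map]; rfl

theorem map_invol {m : ℕ} (τ : Equiv.Perm (Vx m)) (z z' : Option (Fin m) → Bool)
    (h : ∀ v, Umem z (τ v) = Umem z' v) : (Uset z').map τ.toEmbedding = Uset z := by
  ext v
  rw [Finset.mem_map_equiv, mem_Uset, mem_Uset, ← h, Equiv.apply_symm_apply]

theorem conj_invol {m : ℕ} (τ : Equiv.Perm (Vx m)) (y y' : Option (Fin m) → Bool)
    (h : ∀ v, τ (Mfun y v) = Mfun y' (τ v)) : τ * Mperm y * τ⁻¹ = Mperm y' := by
  rw [mul_inv_eq_iff_eq_mul]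
  ext1 v
  exact h v

theorem cutN_eq {V : Type*} (U s : Finset V) (f : Equiv.Perm V)
    (h : ∀ v, (v ∈ U ∧ f v ∉ U) ↔ v ∈ s) : cutN U f = s.card := by
  unfold cutN
  congr 1
  ext v
  rw [Finset.mem_filter, h]

/-- The embedding of the first special side. -/
def cEmb (m : ℕ) : Fin 5 ↪ Vx m :=
  ⟨fun j => Sum.inr (Sum.inr (j, false)), fun a b h => by simpa using h⟩

theorem cEmb_apply (m : ℕ) (j : Fin 5) : cEmb m j = Sum.inr (Sum.inr (j, false)) := rfl

/-- cut of size three. -/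
theorem cut_three {m : ℕ} (y z : Option (Fin m) → Bool) (hy : y none = false)
    (hz : z none = false) : cutN (Uset z) (Mperm y) = 3 := by
  rw [cutN_eq (Uset z) (({2, 3, 4} : Finset (Fin 5)).map (cEmb m)), Finset.card_map]
  · simp
  · intro v
    simp only [mem_Uset, Mperm_apply, Finset.mem_map, cEmb_apply]
    rcases v with (⟨r', s⟩ | ⟨r', s, s'⟩ | ⟨j, w⟩)
    · simp [Umem, Mfun]
    · simp [Umem]
    · fin_cases j <;> cases w <;> simp [Umem, Mfun, Cmem, Cfun, hy, hz]

/-- cut of size five. -/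
theorem cut_five {m : ℕ} (y z : Option (Fin m) → Bool) (hy : y none = true)
    (hz : z none = true) : cutN (Uset z) (Mperm y) = 5 := by
  rw [cutN_eq (Uset z) ((Finset.univ : Finset (Fin 5)).map (cEmb m)), Finset.card_map]
  · simp
  · intro v
    simp only [mem_Uset, Mperm_apply, Finset.mem_map, cEmb_apply]
    rcases v with (⟨r', s⟩ | ⟨r', s, s'⟩ | ⟨j, w⟩)
    · simp [Umem, Mfun]
    · simp [Umem]
    · fin_cases j <;> cases w <;> simp [Umem, Mfun, Cmem, Cfun, hy, hz]

theorem rot_inr (m : ℕ) (i j : Fin 5) (w : Bool) :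
    rot m i (Sum.inr (Sum.inr (j, w))) = Sum.inr (Sum.inr (i + j, w)) := rfl

theorem cut_one_gen {m : ℕ} (i l : Fin 5) (y z : Option (Fin m) → Bool) (hy : y none = false)
    (hz : z none = false)
    (hil : ∀ j w, (Cmem false (i + j) w && !Cmem false (i + (Cfun false j w).1) (Cfun false j w).2)
      = (Nat.beq j.val l.val && !w)) :
    cutN (Uset z) (rot m i * Mperm y * (rot m i)⁻¹) = 1 := by
  rw [cutN_eq (Uset z) {rot m i (Sum.inr (Sum.inr (l, false)))}, Finset.card_singleton]
  intro v
  obtain ⟨v, rfl⟩ := (rot m i).surjective v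
  have hc : (rot m i * Mperm y * (rot m i)⁻¹) (rot m i v) = rot m i (Mfun y v) := by
    simp [Equiv.Perm.mul_apply, Mperm_apply]
  rw [hc, Finset.mem_singleton, (rot m i).injective.eq_iff, mem_Uset, mem_Uset]
  rcases v with (⟨r', s⟩ | ⟨r', s, s'⟩ | ⟨j, w⟩)
  · simp [Umem, Mfun, rot]
  · simp [Umem, rot]
  · have h := hil j w
    simp only [Mfun, hy]
    rw [rot_inr, rot_inr]
    simp only [Umem, hz]
    have e1 : (Sum.inr (Sum.inr (j, w)) : Vx m) = Sum.inr (Sum.inr (l, false)) ↔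
        (Nat.beq j.val l.val && !w) = true := by
      simp [Fin.ext_iff]
    rw [e1, ← h]
    simp

theorem cut_one_two {m : ℕ} (y z : Option (Fin m) → Bool) (hy : y none = false)
    (hz : z none = false) : cutN (Uset z) (rot m 2 * Mperm y * (rot m 2)⁻¹) = 1 := by
  refine cut_one_gen 2 2 y z hy hz ?_
  intro j w
  fin_cases j <;> cases w <;> rfl

theorem cut_one_three {m : ℕ} (y z : Option (Fin m) → Bool) (hy : y none = false)
    (hz : z none = false) : cutN (Uset z) (rot m 3 * Mperm y * (rot m 3)⁻¹) = 1 := by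
  refine cut_one_gen 3 4 y z hy hz ?_
  intro j w
  fin_cases j <;> cases w <;> rfl

/-- The odd sets are odd. -/
theorem Uset_odd {m : ℕ} (z : Option (Fin m) → Bool) : Odd (Uset z).card := by
  have e : Uset z = ((Finset.univ.filter (fun r : Fin m => z (some r) = true)) ×ˢ
      (Finset.univ : Finset Bool)).map ⟨Sum.inl, Sum.inl_injective⟩ ∪
      (Finset.univ.filter (fun j : Fin 5 => Cmem (z none) j false = true)).map (cEmb m) := by
    ext v
    simp only [mem_Uset, Finset.mem_union, Finset.mem_map, Finset.mem_product, Finset.mem_filter,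
      cEmb_apply]
    rcases v with (⟨r', s⟩ | ⟨r', s, s'⟩ | ⟨j, w⟩)
    · simp [Umem]
    · simp [Umem]
    · cases w
      · simp [Umem]
      · simp [Umem, Cmem]
  rw [e, Finset.card_union_of_disjoint, Finset.card_map, Finset.card_map, Finset.card_product]
  · have : Odd (Finset.univ.filter (fun j : Fin 5 => Cmem (z none) j false = true)).card := by
      cases z none
      · have : (Finset.univ.filter (fun j : Fin 5 => Cmem false j false = true)) = {2, 3, 4} := by
          ext j
          rw [Finset.mem_filter]
          fin_cases j <;> simp [Cmem]
        rw [this]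
        simp
        exact ⟨1, rfl⟩
      · have : (Finset.univ.filter (fun j : Fin 5 => Cmem true j false = true)) =
            Finset.univ := by
          ext j
          simp [Cmem_true]
        rw [this]
        simp
        exact ⟨2, rfl⟩
    refine Even.add_odd ?_ this
    simp
  · rw [Finset.disjoint_left]
    intro v h1 h2
    simp only [Finset.mem_map, cEmb_apply] at h1 h2
    obtain ⟨a, _, rfl⟩ := h1
    obtain ⟨b, _, hb⟩ := h2
    simp at hb

/-! ### Part 3: the rectangle bound -/

theorem prod_perturb (a b a' b' : ℝ) (ha : 0 ≤ a) (hb : 0 ≤ b) (ha' : 0 ≤ a') (hb' : 0 ≤ b') :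
    a * b ≤ a' * b' + |a - a'| * b + a * |b - b'| := by
  have h1 : a - a' ≤ |a - a'| := le_abs_self _
  have h2 : b - b' ≤ |b - b'| := le_abs_self _
  have h3 := abs_nonneg (a - a')
  have h4 := abs_nonneg (b - b')
  by_cases ha2 : a ≤ |a - a'|
  · have := mul_le_mul_of_nonneg_right ha2 hb
    have := mul_nonneg ha' hb'
    have := mul_nonneg ha h4
    linarith
  by_cases hb2 : b ≤ |b - b'|
  · have := mul_le_mul_of_nonneg_left hb2 ha
    have := mul_nonneg ha' hb'
    have := mul_nonneg h3 hb
    linarith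
  push Not at ha2 hb2
  have : (a - |a - a'|) * (b - |b - b'|) ≤ a' * b' :=
    mul_le_mul (by linarith) (by linarith) (by linarith) ha'
  nlinarith [mul_nonneg h3 h4]

theorem five_cycle (p q : Fin 5 → ℝ) (p' q' : ℝ) (hp : ∀ i, 0 ≤ p i) (hq : ∀ i, 0 ≤ q i)
    (hp' : 0 ≤ p') (hq' : 0 ≤ q') (h2 : ∀ i, q i * p (i + 2) = 0) :
    ∑ i, p i * q i ≤ 2 * (p' * q') + ∑ i, (|p i - p'| * q i + p i * |q i - q'|) := by
  have hb : ∀ i, p i * q i ≤ p' * q' + (|p i - p'| * q i + p i * |q i - q'|) := fun i => by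
    have := prod_perturb (p i) (q i) p' q' (hp i) (hq i) hp' hq'
    linarith
  have he : ∀ i, 0 ≤ |p i - p'| * q i + p i * |q i - q'| := fun i =>
    add_nonneg (mul_nonneg (abs_nonneg _) (hq i)) (mul_nonneg (hp i) (abs_nonneg _))
  have ht : 0 ≤ p' * q' := mul_nonneg hp' hq'
  have hz : ∀ i, p i * q i = 0 ∨ p (i + 2) * q (i + 2) = 0 := by
    intro i
    rcases mul_eq_zero.1 (h2 i) with h | h
    · left; rw [h, mul_zero]
    · right; rw [h, zero_mul]
  generalize hE : (fun i => |p i - p'| * q i + p i * |q i - q'|) = E at *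
  have hE' : ∀ i, |p i - p'| * q i + p i * |q i - q'| = E i := fun i => congrFun hE i
  simp only [hE'] at *
  generalize hX : (fun i => p i * q i) = X at *
  have hX' : ∀ i, p i * q i = X i := fun i => congrFun hX i
  simp only [hX'] at *
  rw [Fin.sum_univ_five, Fin.sum_univ_five]
  have z0 : X 0 = 0 ∨ X 2 = 0 := hz 0
  have z1 : X 1 = 0 ∨ X 3 = 0 := hz 1
  have z2 : X 2 = 0 ∨ X 4 = 0 := hz 2
  have z3 : X 3 = 0 ∨ X 0 = 0 := hz 3
  have z4 : X 4 = 0 ∨ X 1 = 0 := hz 4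
  have := hb 0; have := hb 1; have := hb 2; have := hb 3; have := hb 4
  have := he 0; have := he 1; have := he 2; have := he 3; have := he 4
  rcases z0 with z0 | z0 <;> rcases z1 with z1 | z1 <;> rcases z2 with z2 | z2 <;>
    rcases z3 with z3 | z3 <;> rcases z4 with z4 | z4 <;> linarith

noncomputable instance permVxFintype (m : ℕ) : Fintype (Equiv.Perm (Vx m)) := Fintype.ofFinite _

/-- Sum of `v` over the matchings. -/
noncomputable def Pf {m : ℕ} (v : Equiv.Perm (Vx m) → ℝ) (b : Bool) (σ : Equiv.Perm (Vx m)) : ℝ :=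
  ∑ y ∈ Finset.univ.filter (fun y : Option (Fin m) → Bool => y none = b), v (σ * Mperm y * σ⁻¹)

/-- Sum of `u` over the odd sets. -/
noncomputable def Qf {m : ℕ} (u : Finset (Vx m) → ℝ) (b : Bool) (σ : Equiv.Perm (Vx m)) : ℝ :=
  ∑ z ∈ Finset.univ.filter (fun z : Option (Fin m) → Bool => z none = b),
    u ((Uset z).map σ.toEmbedding)

theorem conj_mul' {m : ℕ} (σ τ f : Equiv.Perm (Vx m)) :
    (σ * τ) * f * (σ * τ)⁻¹ = σ * (τ * f * τ⁻¹) * σ⁻¹ := by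
  group

theorem Pf_tauA {m : ℕ} (v : Equiv.Perm (Vx m) → ℝ) (σ : Equiv.Perm (Vx m)) (r : Option (Fin m)) :
    Pf v false (σ * tauA r) = Pf v false σ := by
  refine Finset.sum_congr rfl fun y hy => ?_
  rw [Finset.mem_filter] at hy
  rw [conj_mul']
  congr 3
  cases r with
  | none => simp [tauA]
  | some r =>
    refine conj_invol _ _ _ fun v => ?_
    have h := tAfun_M r y hy.2 (tAfun r v)
    rw [tAfun_invol r v] at h
    exact h

theorem Qf_tauB {m : ℕ} (u : Finset (Vx m) → ℝ) (σ : Equiv.Perm (Vx m)) (r : Option (Fin m)) :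
    Qf u false (σ * tauB r) = Qf u false σ := by
  refine Finset.sum_congr rfl fun z hz => ?_
  rw [Finset.mem_filter] at hz
  rw [finmap_mul]
  congr 2
  cases r with
  | none => exact Finset.map_refl
  | some r => exact map_invol _ _ _ fun v => tBfun_U r z hz.2 v

theorem Pf_rot {m : ℕ} (v : Equiv.Perm (Vx m) → ℝ) (σ : Equiv.Perm (Vx m)) (i : Fin 5) :
    Pf v true (σ * rot m i) = Pf v true σ := by
  refine Finset.sum_congr rfl fun y hy => ?_
  rw [Finset.mem_filter] at hy
  rw [conj_mul']
  congr 3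
  exact conj_invol _ _ _ fun v => rot_M i y hy.2 v

theorem Qf_rot {m : ℕ} (u : Finset (Vx m) → ℝ) (σ : Equiv.Perm (Vx m)) (i : Fin 5) :
    Qf u true (σ * rot m i) = Qf u true σ := by
  refine Finset.sum_congr rfl fun z hz => ?_
  rw [Finset.mem_filter] at hz
  rw [finmap_mul]
  congr 2
  exact map_invol _ _ _ fun v => rot_U i z hz.2 v

theorem swap_swap_comp {m : ℕ} (z : Option (Fin m) → Bool) (r : Option (Fin m)) :
    (z ∘ Equiv.swap none r) ∘ Equiv.swap none r = z := by
  ext i; simp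

theorem u_tauA {m : ℕ} (u : Finset (Vx m) → ℝ) (σ : Equiv.Perm (Vx m)) (r : Option (Fin m))
    (z : Option (Fin m) → Bool) :
    u ((Uset z).map (σ * tauA r).toEmbedding) =
      u ((Uset (z ∘ Equiv.swap none r)).map σ.toEmbedding) := by
  rw [finmap_mul]
  congr 2
  cases r with
  | none =>
    rw [Equiv.swap_self]
    exact Finset.map_refl
  | some r =>
    refine map_invol _ _ _ fun v => ?_
    have h := tAfun_U r (z ∘ Equiv.swap none (some r)) v
    rw [swap_swap_comp] at h
    exact h

theorem v_tauB {m : ℕ} (v : Equiv.Perm (Vx m) → ℝ) (σ : Equiv.Perm (Vx m)) (r : Option (Fin m))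
    (y : Option (Fin m) → Bool) :
    v ((σ * tauB r) * Mperm y * (σ * tauB r)⁻¹) =
      v (σ * Mperm (y ∘ Equiv.swap none r) * σ⁻¹) := by
  rw [conj_mul']
  congr 3
  cases r with
  | none => simp [tauB]
  | some r =>
    refine conj_invol _ _ _ fun v => ?_
    have h := tBfun_M r y (tBfun r v)
    rw [tBfun_invol r v] at h
    exact h

theorem split_none {m : ℕ} (F : (Option (Fin m) → Bool) → ℝ) :
    ∑ z, F z = ∑ z ∈ Finset.univ.filter (fun z : Option (Fin m) → Bool => z none = false), F z +
      ∑ z ∈ Finset.univ.filter (fun z : Option (Fin m) → Bool => z none = true), F z := by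
  rw [← Finset.sum_filter_add_sum_filter_not Finset.univ
    (fun z : Option (Fin m) → Bool => z none = false)]
  congr 2
  ext z
  simp

theorem split_none_sgn {m : ℕ} (F : (Option (Fin m) → Bool) → ℝ) :
    ∑ z, bsgn (z none) * F z =
      ∑ z ∈ Finset.univ.filter (fun z : Option (Fin m) → Bool => z none = true), F z -
      ∑ z ∈ Finset.univ.filter (fun z : Option (Fin m) → Bool => z none = false), F z := by
  rw [split_none, add_comm, sub_eq_add_neg, ← Finset.sum_neg_distrib]
  congr 1
  · refine Finset.sum_congr rfl fun z hz => ?_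
    rw [Finset.mem_filter] at hz
    simp [bsgn, hz.2]
  · refine Finset.sum_congr rfl fun z hz => ?_
    rw [Finset.mem_filter] at hz
    simp [bsgn, hz.2]

theorem card_none {m : ℕ} (b : Bool) :
    (Finset.univ.filter (fun z : Option (Fin m) → Bool => z none = b)).card = 2 ^ m := by
  have h1 : (Finset.univ.filter (fun z : Option (Fin m) → Bool => z none = b)) =
      (Finset.univ : Finset (Fin m → Bool)).map
        ⟨fun x i => Option.elim i b x, fun x x' h => funext fun i => congrFun h (some i)⟩ := by
    ext z
    simp only [Finset.mem_filter, Finset.mem_univ, true_and, Finset.mem_map]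
    constructor
    · intro h
      refine ⟨fun i => z (some i), ?_⟩
      funext i
      cases i with
      | none => exact h.symm
      | some i => rfl
    · rintro ⟨x, rfl⟩
      rfl
  rw [h1, Finset.card_map]
  simp

theorem Pf_nonneg {m : ℕ} (v : Equiv.Perm (Vx m) → ℝ) (hv : ∀ f, 0 ≤ v f) (b : Bool)
    (σ : Equiv.Perm (Vx m)) : 0 ≤ Pf v b σ := Finset.sum_nonneg fun _ _ => hv _

theorem Qf_nonneg {m : ℕ} (u : Finset (Vx m) → ℝ) (hu : ∀ f, 0 ≤ u f) (b : Bool)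
    (σ : Equiv.Perm (Vx m)) : 0 ≤ Qf u b σ := Finset.sum_nonneg fun _ _ => hu _

theorem Pf_le {m : ℕ} (v : Equiv.Perm (Vx m) → ℝ) (B : ℝ) (hv : ∀ f, v f ≤ B) (b : Bool)
    (σ : Equiv.Perm (Vx m)) : Pf v b σ ≤ 2 ^ m * B := by
  refine (Finset.sum_le_card_nsmul _ _ B fun _ _ => hv _).trans ?_
  rw [card_none]; simp

theorem Qf_le {m : ℕ} (u : Finset (Vx m) → ℝ) (B : ℝ) (hu : ∀ f, u f ≤ B) (b : Bool)
    (σ : Equiv.Perm (Vx m)) : Qf u b σ ≤ 2 ^ m * B := by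
  refine (Finset.sum_le_card_nsmul _ _ B fun _ _ => hu _).trans ?_
  rw [card_none]; simp

theorem rect_bound {m : ℕ} (u : Finset (Vx m) → ℝ) (v : Equiv.Perm (Vx m) → ℝ) (Bu Bv : ℝ)
    (hu : ∀ U, 0 ≤ u U) (hv : ∀ f, 0 ≤ v f) (hBu : ∀ U, u U ≤ Bu) (hBv : ∀ f, v f ≤ Bv)
    (hz : ∀ U f, cutN U f = 1 → u U * v f = 0) :
    ∑ σ, Pf v false σ * Qf u false σ ≤ (42 / 100) * ∑ σ, Pf v true σ * Qf u true σ +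
      6 * (4 ^ m * (Bu * Bv) * Real.exp (-((m + 1 : ℝ) / 20000)) *
        Fintype.card (Equiv.Perm (Vx m))) := by
  have hP := Pf_nonneg v hv
  have hQ := Qf_nonneg u hu
  set η := Real.exp (-((m + 1 : ℝ) / 20000)) with hη
  have hη0 : 0 < η := Real.exp_pos _
  set X := ∑ σ, Pf v false σ * Qf u false σ with hX
  set Y := ∑ σ, Pf v true σ * Qf u true σ with hY
  set E1 := ∑ σ, Pf v false σ * |Qf u false σ - Qf u true σ| with hE1
  set E2 := ∑ σ, |Pf v false σ - Pf v true σ| * Qf u false σ with hE2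
  set err := 4 ^ m * (Bu * Bv) * η * Fintype.card (Equiv.Perm (Vx m)) with herr
  have hBu0 : 0 ≤ Bu := (hu ∅).trans (hBu _)
  have hBv0 : 0 ≤ Bv := (hv 1).trans (hBv _)
  have hexp : Real.exp (-((1 / 100 : ℝ) ^ 2 / 2 * (Fintype.card (Option (Fin m)) : ℝ))) = η := by
    rw [hη]; congr 1; simp; ring
  have hpow : (2 : ℝ) ^ (Fintype.card (Option (Fin m))) = 2 * 2 ^ m := by
    simp [pow_succ]; ring
  have h4 : (4 : ℝ) ^ m = 2 ^ m * 2 ^ m := by rw [← mul_pow]; norm_num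
  -- first error term
  have b1 : E1 ≤ (1 / 100) * (2 * X + E1) + 2 * err := by
    have h := view_bound (none : Option (Fin m)) tauA (fun σ => Pf v false σ)
      (fun σ z => u ((Uset z).map σ.toEmbedding)) Bu (1 / 100) (by norm_num) (hP false)
      (fun _ _ => hu _) (fun _ _ => hBu _) (Pf_tauA v) (u_tauA u)
    rw [hexp, hpow] at h
    have e1 : ∑ σ : Equiv.Perm (Vx m), Pf v false σ *
        |∑ z, bsgn (z none) * u ((Uset z).map σ.toEmbedding)| = E1 := by
      refine Finset.sum_congr rfl fun σ _ => ?_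
      rw [split_none_sgn, abs_sub_comm]; rfl
    have e2 : ∑ σ : Equiv.Perm (Vx m), Pf v false σ * ∑ z, u ((Uset z).map σ.toEmbedding) ≤
        2 * X + E1 := by
      rw [hX, hE1, Finset.mul_sum, ← Finset.sum_add_distrib]
      refine Finset.sum_le_sum fun σ _ => ?_
      rw [split_none]
      change Pf v false σ * (Qf u false σ + Qf u true σ) ≤ _
      have := neg_abs_le (Qf u false σ - Qf u true σ)
      nlinarith [hP false σ]
    have e3 : ∑ σ : Equiv.Perm (Vx m), Pf v false σ ≤
        Fintype.card (Equiv.Perm (Vx m)) * (2 ^ m * Bv) := by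
      refine (Finset.sum_le_card_nsmul _ _ _ fun σ _ => Pf_le v Bv hBv false σ).trans ?_
      simp [Finset.card_univ]
    have e4 : Bu * (2 * 2 ^ m * η) * ∑ σ : Equiv.Perm (Vx m), Pf v false σ ≤ 2 * err := by
      refine (mul_le_mul_of_nonneg_left e3 (by positivity)).trans (le_of_eq ?_)
      rw [herr, h4]; ring
    rw [e1] at h
    linarith
  have b2 : E2 ≤ (1 / 100) * (2 * X + E2) + 2 * err := by
    have h := view_bound (none : Option (Fin m)) tauB (fun σ => Qf u false σ)
      (fun σ y => v (σ * Mperm y * σ⁻¹)) Bv (1 / 100) (by norm_num) (hQ false)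
      (fun _ _ => hv _) (fun _ _ => hBv _) (Qf_tauB u) (v_tauB v)
    rw [hexp, hpow] at h
    have e1 : ∑ σ : Equiv.Perm (Vx m), Qf u false σ *
        |∑ y, bsgn (y none) * v (σ * Mperm y * σ⁻¹)| = E2 := by
      refine Finset.sum_congr rfl fun σ _ => ?_
      rw [split_none_sgn, abs_sub_comm, mul_comm]; rfl
    have e2 : ∑ σ : Equiv.Perm (Vx m), Qf u false σ * ∑ y, v (σ * Mperm y * σ⁻¹) ≤
        2 * X + E2 := by
      rw [hX, hE2, Finset.mul_sum, ← Finset.sum_add_distrib]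
      refine Finset.sum_le_sum fun σ _ => ?_
      rw [split_none]
      change Qf u false σ * (Pf v false σ + Pf v true σ) ≤ _
      have := neg_abs_le (Pf v false σ - Pf v true σ)
      nlinarith [hQ false σ]
    have e3 : ∑ σ : Equiv.Perm (Vx m), Qf u false σ ≤
        Fintype.card (Equiv.Perm (Vx m)) * (2 ^ m * Bu) := by
      refine (Finset.sum_le_card_nsmul _ _ _ fun σ _ => Qf_le u Bu hBu false σ).trans ?_
      simp [Finset.card_univ]
    have e4 : Bv * (2 * 2 ^ m * η) * ∑ σ : Equiv.Perm (Vx m), Qf u false σ ≤ 2 * err := by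
      refine (mul_le_mul_of_nonneg_left e3 (by positivity)).trans (le_of_eq ?_)
      rw [herr, h4]; ring
    rw [e1] at h
    linarith
  -- disjointness
  have hdis2 : ∀ σ, Qf u false σ * Pf v false (σ * rot m 2) = 0 := by
    intro σ
    rw [Qf, Pf, Finset.sum_mul_sum]
    refine Finset.sum_eq_zero fun z hz' => Finset.sum_eq_zero fun y hy' => ?_
    rw [Finset.mem_filter] at hz' hy'
    apply hz
    rw [conj_mul', cutN_conj, cut_one_two y z hy'.2 hz'.2]
  have main : 5 * X ≤ 2 * Y + 5 * (E1 + E2) := by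
    have hσ : ∀ σ : Equiv.Perm (Vx m),
        ∑ i, Pf v false (σ * rot m i) * Qf u false (σ * rot m i) ≤
        2 * (Pf v true σ * Qf u true σ) +
        ∑ i, (|Pf v false (σ * rot m i) - Pf v true (σ * rot m i)| * Qf u false (σ * rot m i) +
          Pf v false (σ * rot m i) * |Qf u false (σ * rot m i) - Qf u true (σ * rot m i)|) := by
      intro σ
      have := five_cycle (fun i => Pf v false (σ * rot m i)) (fun i => Qf u false (σ * rot m i))
        (Pf v true σ) (Qf u true σ) (fun i => hP _ _) (fun i => hQ _ _) (hP _ _) (hQ _ _)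
        (fun i => by
          have := hdis2 (σ * rot m i)
          rwa [mul_assoc, rot_mul] at this)
      simpa only [Pf_rot, Qf_rot] using this
    have hsum := Finset.sum_le_sum fun σ (_ : σ ∈ (Finset.univ : Finset (Equiv.Perm (Vx m)))) => hσ σ
    rw [Finset.sum_add_distrib, ← Finset.mul_sum] at hsum
    rw [Finset.sum_comm] at hsum
    rw [Finset.sum_comm (s := (Finset.univ : Finset (Equiv.Perm (Vx m))))
      (t := (Finset.univ : Finset (Fin 5)))] at hsum
    have t1 : ∀ i : Fin 5, ∑ σ, Pf v false (σ * rot m i) * Qf u false (σ * rot m i) = X := fun i =>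
      Equiv.sum_comp (Equiv.mulRight (rot m i)) (fun σ => Pf v false σ * Qf u false σ)
    have t2 : ∀ i : Fin 5, ∑ σ,
        (|Pf v false (σ * rot m i) - Pf v true (σ * rot m i)| * Qf u false (σ * rot m i) +
          Pf v false (σ * rot m i) * |Qf u false (σ * rot m i) - Qf u true (σ * rot m i)|) =
        E2 + E1 := fun i => by
      rw [hE1, hE2, ← Finset.sum_add_distrib]
      exact Equiv.sum_comp (Equiv.mulRight (rot m i)) (fun σ =>
        |Pf v false σ - Pf v true σ| * Qf u false σ + Pf v false σ * |Qf u false σ - Qf u true σ|)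
    simp only [t1, t2] at hsum
    simp at hsum
    linarith
  have hY0 : 0 ≤ Y := Finset.sum_nonneg fun σ _ => mul_nonneg (hP _ _) (hQ _ _)
  have herr0 : 0 ≤ err := by positivity
  linarith

/-- Exponential lower bound for the nonnegative rank of the matching slack matrix. -/
theorem rank_bound {m : ℕ} {R : Type*} [Fintype R] (u : R → Finset (Vx m) → ℝ)
    (v : R → Equiv.Perm (Vx m) → ℝ)
    (hu : ∀ l U, Odd U.card → 0 ≤ u l U)
    (hv : ∀ l (f : Equiv.Perm (Vx m)), Function.Involutive f → (∀ x, f x ≠ x) → 0 ≤ v l f)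
    (hS : ∀ (U : Finset (Vx m)) (f : Equiv.Perm (Vx m)), Odd U.card → Function.Involutive f → (∀ x, f x ≠ x) →
      ∑ l, u l U * v l f = (cutN U f : ℝ) - 1) :
    1 ≤ 80 * Real.exp (-((m + 1 : ℝ) / 20000)) * (Fintype.card R * (6 * m + 10)) := by
  set η := Real.exp (-((m + 1 : ℝ) / 20000)) with hη
  have hη0 : 0 < η := Real.exp_pos _
  let u' : R → Finset (Vx m) → ℝ := fun l U => if Odd U.card then u l U else 0
  let v' : R → Equiv.Perm (Vx m) → ℝ := fun l f =>
    if Function.Involutive f ∧ (∀ x, f x ≠ x) then v l f else 0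
  have hu' : ∀ l U, 0 ≤ u' l U := fun l U => by
    by_cases h : Odd U.card
    · simp only [u', h, if_true]; exact hu l U h
    · simp only [u', h, if_false]; exact le_rfl
  have hv' : ∀ l f, 0 ≤ v' l f := fun l f => by
    by_cases h : Function.Involutive f ∧ (∀ x, f x ≠ x)
    · simp only [v']; rw [if_pos h]; exact hv l f h.1 h.2
    · simp only [v']; rw [if_neg h]
  have hprod : ∀ l U f, u' l U * v' l f ≤ 6 * m + 10 ∧
      (cutN U f = 1 → u' l U * v' l f = 0) := by
    intro l U f
    by_cases h1 : Odd U.card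
    · by_cases h2 : Function.Involutive f ∧ (∀ x, f x ≠ x)
      · have h3 := hS U f h1 h2.1 h2.2
        have h4 : u' l U * v' l f ≤ ∑ l, u l U * v l f := by
          have : u' l U * v' l f = u l U * v l f := by
            simp only [u', v']; rw [if_pos h1, if_pos h2]
          rw [this]
          exact Finset.single_le_sum (f := fun l => u l U * v l f)
            (fun l _ => mul_nonneg (hu l U h1) (hv l f h2.1 h2.2)) (Finset.mem_univ l)
        rw [h3] at h4
        constructor
        · have h5 : cutN U f ≤ 6 * m + 10 := by
            have : cutN U f ≤ Fintype.card (Vx m) := (Finset.card_le_univ _)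
            simp at this
            omega
          have h6 : (cutN U f : ℝ) ≤ 6 * m + 10 := by exact_mod_cast h5
          linarith
        · intro h5
          rw [h5] at h4
          have := mul_nonneg (hu' l U) (hv' l f)
          norm_num at h4
          linarith
      · have : v' l f = 0 := by simp only [v']; rw [if_neg h2]
        rw [this, mul_zero]
        exact ⟨by positivity, fun _ => rfl⟩
    · have : u' l U = 0 := by simp only [u']; rw [if_neg h1]
      rw [this, zero_mul]
      exact ⟨by positivity, fun _ => rfl⟩
  have hrect : ∀ l, ∑ σ, Pf (v' l) false σ * Qf (u' l) false σ ≤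
      (42 / 100) * ∑ σ, Pf (v' l) true σ * Qf (u' l) true σ +
      6 * (4 ^ m * (6 * m + 10) * η * Fintype.card (Equiv.Perm (Vx m))) := by
    intro l
    obtain ⟨U0, _, hU0⟩ := Finset.exists_max_image (Finset.univ : Finset (Finset (Vx m)))
      (u' l) ⟨∅, Finset.mem_univ _⟩
    obtain ⟨f0, _, hf0⟩ := Finset.exists_max_image (Finset.univ : Finset (Equiv.Perm (Vx m)))
      (v' l) ⟨1, Finset.mem_univ _⟩
    refine (rect_bound (u' l) (v' l) (u' l U0) (v' l f0) (hu' l) (hv' l)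
      (fun U => hU0 U (Finset.mem_univ _)) (fun f => hf0 f (Finset.mem_univ _))
      (fun U f => (hprod l U f).2)).trans ?_
    have := (hprod l U0 f0).1
    gcongr
  have hval : ∀ b σ, ∑ l, Pf (v' l) b σ * Qf (u' l) b σ =
      4 ^ m * (if b = true then (4 : ℝ) else 2) := by
    intro b σ
    simp only [Pf, Qf, Finset.sum_mul_sum]
    rw [Finset.sum_comm]
    have : ∀ y ∈ Finset.univ.filter (fun y : Option (Fin m) → Bool => y none = b),
        ∑ l, ∑ z ∈ Finset.univ.filter (fun y : Option (Fin m) → Bool => y none = b),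
          v' l (σ * Mperm y * σ⁻¹) * u' l ((Uset z).map σ.toEmbedding) =
        2 ^ m * (if b = true then (4 : ℝ) else 2) := by
      intro y hy
      rw [Finset.sum_comm]
      have h2 : ∀ z ∈ Finset.univ.filter (fun y : Option (Fin m) → Bool => y none = b),
          ∑ l, v' l (σ * Mperm y * σ⁻¹) * u' l ((Uset z).map σ.toEmbedding) =
            (if b = true then (4 : ℝ) else 2) := by
        intro z hz
        rw [Finset.mem_filter] at hy hz
        have hodd : Odd ((Uset z).map σ.toEmbedding).card := by
          rw [Finset.card_map]; exact Uset_odd z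
        have hinv : Function.Involutive (σ * Mperm y * σ⁻¹) := by
          intro x
          simp only [Equiv.Perm.mul_apply, Mperm_apply]
          simp [Mfun_invol y _]
        have hne : ∀ x, (σ * Mperm y * σ⁻¹) x ≠ x := by
          intro x hx
          simp only [Equiv.Perm.mul_apply, Mperm_apply] at hx
          apply Mfun_ne y (σ⁻¹ x)
          apply σ.injective
          rw [hx]; simp
        have h3 := hS _ _ hodd hinv hne
        rw [cutN_conj] at h3
        have h4 : ∑ l, v' l (σ * Mperm y * σ⁻¹) * u' l ((Uset z).map σ.toEmbedding) =
            ∑ l, u l ((Uset z).map σ.toEmbedding) * v l (σ * Mperm y * σ⁻¹) := by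
          refine Finset.sum_congr rfl fun l _ => ?_
          simp only [u', v']
          rw [if_pos hodd, if_pos ⟨hinv, hne⟩, mul_comm]
        rw [h4, h3]
        cases b with
        | false => rw [cut_three y z hy.2 hz.2]; norm_num
        | true => rw [cut_five y z hy.2 hz.2]; norm_num
      rw [Finset.sum_congr rfl h2, Finset.sum_const, card_none]
      simp
    rw [Finset.sum_congr rfl this, Finset.sum_const, card_none]
    have h4 : (4 : ℝ) ^ m = 2 ^ m * 2 ^ m := by rw [← mul_pow]; norm_num
    rw [h4]; simp; ring
  have htot := Finset.sum_le_sum fun l (_ : l ∈ (Finset.univ : Finset R)) => hrect l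
  rw [Finset.sum_comm, Finset.sum_add_distrib, ← Finset.mul_sum, Finset.sum_comm (γ := R)] at htot
  simp only [hval] at htot
  simp only [Finset.sum_const, Finset.card_univ, nsmul_eq_mul, if_true] at htot
  simp only [Bool.false_eq_true, if_false] at htot
  set G : ℝ := (Fintype.card (Equiv.Perm (Vx m)) : ℝ) with hG
  have hG0 : 0 < G := by
    have : 0 < Fintype.card (Equiv.Perm (Vx m)) := Fintype.card_pos
    rw [hG]; exact_mod_cast this
  have h4m : (0 : ℝ) < 4 ^ m := by positivity
  have hGm : 0 < G * 4 ^ m := mul_pos hG0 h4m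
  have : (G * 4 ^ m) * (32 / 100) ≤ (G * 4 ^ m) * (6 * η * (Fintype.card R * (6 * m + 10))) := by
    nlinarith
  have := le_of_mul_le_mul_left this hGm
  linarith

/-! ### Part 4: Farkas and Yannakakis -/

theorem farkas_fin {V : Type*} [AddCommGroup V] [Module ℝ V] (k : ℕ) :
    ∀ (A : Fin k → V →ₗ[ℝ] ℝ) (g : V →ₗ[ℝ] ℝ),
      (∀ x, (∀ i, A i x ≤ 0) → g x ≤ 0) →
      ∃ c : Fin k → ℝ, (∀ i, 0 ≤ c i) ∧ ∀ x, g x = ∑ i, c i * A i x := by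
  induction k with
  | zero =>
    intro A g hg
    refine ⟨fun _ => 0, fun _ => le_rfl, fun x => ?_⟩
    have h1 := hg x (fun i => i.elim0)
    have h2 := hg (-x) (fun i => i.elim0)
    rw [map_neg] at h2
    simp
    linarith
  | succ k ih =>
    intro A g hg
    by_cases h : ∀ x, (∀ i : Fin k, A i.succ x ≤ 0) → g x ≤ 0
    · obtain ⟨c, hc, hgc⟩ := ih (fun i => A i.succ) g h
      refine ⟨Fin.cons 0 c, fun i => ?_, fun x => ?_⟩
      · refine Fin.cases ?_ (fun j => ?_) i
        · simp
        · simpa using hc j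
      · rw [Fin.sum_univ_succ]
        simp [hgc x]
    · push Not at h
      obtain ⟨x0, hx0, hgx0⟩ := h
      have hA0 : 0 < A 0 x0 := by
        by_contra hcon
        push Not at hcon
        have : g x0 ≤ 0 := hg x0 (fun i => by
          refine Fin.cases hcon (fun j => hx0 j) i)
        linarith
      set a := A 0 x0 with ha
      obtain ⟨c, hc, hgc⟩ := ih (fun i => A i.succ - (A i.succ x0 / a) • A 0)
        (g - (g x0 / a) • A 0) (fun x hx => by
          have h1 := hg (x - (A 0 x / a) • x0) (fun i => by
            refine Fin.cases ?_ (fun j => ?_) i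
            · simp only [map_sub, map_smul, smul_eq_mul]
              rw [← ha]
              field_simp
              simp
            · have := hx j
              simp only [LinearMap.sub_apply, LinearMap.smul_apply, smul_eq_mul] at this
              simp only [map_sub, map_smul, smul_eq_mul]
              have e : A 0 x / a * A j.succ x0 = A j.succ x0 / a * A 0 x := by ring
              rw [e]; exact this)
          simp only [map_sub, map_smul, smul_eq_mul] at h1
          simp only [LinearMap.sub_apply, LinearMap.smul_apply, smul_eq_mul]
          have e : A 0 x / a * g x0 = g x0 / a * A 0 x := by ring
          rw [← e]; exact h1)
      refine ⟨Fin.cons ((g x0 - ∑ i, c i * A i.succ x0) / a) c, fun i => ?_, fun x => ?_⟩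
      · refine Fin.cases ?_ (fun j => ?_) i
        · simp only [Fin.cons_zero]
          apply div_nonneg _ hA0.le
          have : ∑ i, c i * A i.succ x0 ≤ 0 :=
            Finset.sum_nonpos fun i _ => mul_nonpos_of_nonneg_of_nonpos (hc i) (hx0 i)
          linarith
        · simpa using hc j
      · have h1 := hgc x
        simp only [LinearMap.sub_apply, LinearMap.smul_apply, smul_eq_mul, mul_sub,
          Finset.sum_sub_distrib] at h1
        rw [Fin.sum_univ_succ]
        simp only [Fin.cons_zero, Fin.cons_succ]
        have e : ∑ i, c i * (A i.succ x0 / a * A 0 x) = (∑ i, c i * A i.succ x0) / a * A 0 x := by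
          rw [Finset.sum_div, Finset.sum_mul]
          exact Finset.sum_congr rfl fun i _ => by ring
        rw [e] at h1
        rw [sub_div, sub_mul]
        linarith

theorem farkas_affine {E : Type*} [AddCommGroup E] [Module ℝ E] {k : ℕ}
    (A : Fin k → E →ₗ[ℝ] ℝ) (b : Fin k → ℝ) (g : E →ₗ[ℝ] ℝ) (γ : ℝ)
    (x0 : E) (hx0 : ∀ i, A i x0 ≤ b i)
    (hg : ∀ x, (∀ i, A i x ≤ b i) → γ ≤ g x) :
    ∃ (c : Fin k → ℝ) (d : ℝ), (∀ i, 0 ≤ c i) ∧ 0 ≤ d ∧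
      ∀ x, g x - γ = ∑ i, c i * (b i - A i x) + d := by
  let F : Fin (k + 1) → (E × ℝ) →ₗ[ℝ] ℝ := Fin.cons (-(LinearMap.snd ℝ E ℝ))
    (fun i => (A i).comp (LinearMap.fst ℝ E ℝ) - (b i) • LinearMap.snd ℝ E ℝ)
  let G : (E × ℝ) →ₗ[ℝ] ℝ := γ • LinearMap.snd ℝ E ℝ - g.comp (LinearMap.fst ℝ E ℝ)
  obtain ⟨c, hc, hG⟩ := farkas_fin (k + 1) F G (by
    rintro ⟨x, s⟩ hx
    have hs : 0 ≤ s := by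
      have := hx 0
      simpa [F] using this
    have hA : ∀ i, A i x ≤ b i * s := fun i => by
      have := hx i.succ
      simp [F] at this
      linarith
    change γ * s - g x ≤ 0
    rcases hs.eq_or_lt with hs0 | hs0
    · subst hs0
      have hA' : ∀ i, A i x ≤ 0 := fun i => by simpa using hA i
      have hr : ∀ r : ℝ, 0 ≤ r → γ ≤ g x0 + r * g x := fun r hr => by
        have := hg (x0 + r • x) (fun i => by
          rw [map_add, map_smul, smul_eq_mul]
          have := mul_nonpos_of_nonneg_of_nonpos hr (hA' i)
          linarith [hx0 i])
        rwa [map_add, map_smul, smul_eq_mul] at this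
      by_contra hcon
      push Not at hcon
      have hgx : g x < 0 := by linarith
      have h0 := hr 0 le_rfl
      have := hr ((g x0 - γ + 1) / (- g x)) (by apply div_nonneg <;> linarith)
      have e : (g x0 - γ + 1) / (- g x) * g x = -(g x0 - γ + 1) := by
        rw [div_neg, neg_mul, div_mul_cancel₀ _ hgx.ne]
      rw [e] at this
      linarith
    · have := hg (s⁻¹ • x) (fun i => by
        rw [map_smul, smul_eq_mul, inv_mul_le_iff₀ hs0]
        linarith [hA i])
      rw [map_smul, smul_eq_mul, le_inv_mul_iff₀ hs0] at this
      linarith)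
  refine ⟨fun i => c i.succ, c 0, fun i => hc _, hc 0, fun x => ?_⟩
  have h := hG (x, 1)
  rw [Fin.sum_univ_succ] at h
  have e : ∑ i : Fin k, c i.succ * F i.succ (x, 1) = - ∑ i : Fin k, c i.succ * (b i - A i x) := by
    rw [← Finset.sum_neg_distrib]
    refine Finset.sum_congr rfl fun i _ => ?_
    simp [F]
    ring
  rw [e] at h
  simp [F, G] at h
  linarith

theorem xc_attained {ι : Type*} [Fintype ι] (Q : Set (ι → ℝ)) (hQ : IsPolyhedron Q) :
    ∃ (m : ℕ) (A : Matrix (Fin (xc Q)) (Fin m) ℝ) (b : Fin (xc Q) → ℝ)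
      (π : (Fin m → ℝ) →ₗ[ℝ] (ι → ℝ)), π '' {x | A.mulVec x ≤ b} = Q := by
  refine Nat.sInf_mem (s := {k | ∃ (m : ℕ) (A : Matrix (Fin k) (Fin m) ℝ) (b : Fin k → ℝ)
      (π : (Fin m → ℝ) →ₗ[ℝ] (ι → ℝ)), π '' {x | A.mulVec x ≤ b} = Q}) ?_
  obtain ⟨k, A, b, rfl⟩ := hQ
  let e := Fintype.equivFin ι
  refine ⟨k, Fintype.card ι, fun i j => A i (e.symm j), b,
    (LinearMap.funLeft ℝ ℝ e), ?_⟩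
  ext x
  simp only [Set.mem_image, Set.mem_ofPred_eq]
  have key : ∀ (y : Fin (Fintype.card ι) → ℝ) (i : Fin k),
      Matrix.mulVec (fun i j => A i (e.symm j)) y i = ∑ j, A i j * y (e j) := by
    intro y i
    rw [← Equiv.sum_comp e.symm]
    simp [Matrix.mulVec, dotProduct]
  constructor
  · rintro ⟨y, hy, rfl⟩ i
    have := hy i
    rw [key] at this
    exact this
  · intro hx
    refine ⟨fun j => x (e.symm j), fun i => ?_, ?_⟩
    · rw [key]; simpa using hx i
    · ext j; simp [LinearMap.funLeft]

/-- Nonnegative factorisation from an extended formulation. -/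
theorem yannakakis {ι : Type*} [Fintype ι] (Q : Set (ι → ℝ)) (hQ : IsPolyhedron Q)
    (hne : Q.Nonempty) :
    ∃ (w : Option (Fin (xc Q)) → (ι → ℝ) → ℝ), (∀ l, ∀ x ∈ Q, 0 ≤ w l x) ∧
      ∀ (g : (ι → ℝ) →ₗ[ℝ] ℝ) (γ : ℝ), (∀ x ∈ Q, γ ≤ g x) →
        ∃ c : Option (Fin (xc Q)) → ℝ, (∀ l, 0 ≤ c l) ∧
          ∀ x ∈ Q, g x - γ = ∑ l, c l * w l x := by
  obtain ⟨m, A, b, π, hπ⟩ := xc_attained Q hQ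
  have hlift : ∀ x, ∃ y, x ∈ Q → π y = x ∧ A.mulVec y ≤ b := fun x => by
    by_cases hx : x ∈ Q
    · rw [← hπ] at hx
      obtain ⟨y, hy, h⟩ := hx
      exact ⟨y, fun _ => ⟨h, hy⟩⟩
    · exact ⟨0, fun h => absurd h hx⟩
  choose y hy using hlift
  refine ⟨fun l x => l.elim 1 (fun i => b i - A.mulVec (y x) i), fun l x hx => ?_, ?_⟩
  · cases l with
    | none => simp
    | some i => simpa using (hy x hx).2 i
  · intro g γ hg
    obtain ⟨x1, hx1⟩ := hne
    obtain ⟨c, d, hc, hd, h⟩ := farkas_affine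
      (fun i => (LinearMap.proj i).comp (Matrix.mulVecLin A)) b (g.comp π) γ (y x1)
      (fun i => (hy x1 hx1).2 i) (fun x hx => hg _ (by rw [← hπ]; exact ⟨x, hx, rfl⟩))
    refine ⟨fun l => l.elim d c, fun l => ?_, fun x hx => ?_⟩
    · cases l with
      | none => exact hd
      | some i => exact hc i
    · have := h (y x)
      rw [Fintype.sum_option]
      simp only [LinearMap.comp_apply, (hy x hx).1] at this
      simp only [Option.elim]
      rw [this, mul_one, add_comm]
      rfl

/-! ### Part 5, a: tours from cyclic orders -/

theorem cycle_edges (n : ℕ) :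
    Function.Injective (fun p : Fin (n + 3) => s(p, p + 1)) ∧
    ∀ e, e ∈ (cycleGraph.cycle n).edges ↔ ∃ p : Fin (n + 3), s(p, p + 1) = e := by
  have hsub : (cycleGraph.cycle n).edges.toFinset ⊆
      Finset.univ.image (fun p : Fin (n + 3) => s(p, p + 1)) := by
    intro e he
    rw [List.mem_toFinset] at he
    have h1 := (cycleGraph.cycle n).edges_subset_edgeSet he
    induction e using Sym2.ind with
    | _ u v =>
      rw [SimpleGraph.mem_edgeSet, cycleGraph_adj] at h1
      rw [Finset.mem_image]
      rcases h1 with h1 | h1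
      · refine ⟨v, Finset.mem_univ _, ?_⟩
        have : v + 1 = u := by rw [← h1]; abel
        rw [this, Sym2.eq_swap]
      · refine ⟨u, Finset.mem_univ _, ?_⟩
        have : u + 1 = v := by rw [← h1]; abel
        rw [this]
  have hcard : (cycleGraph.cycle n).edges.toFinset.card = n + 3 := by
    rw [List.toFinset_card_of_nodup cycleGraph.isCycle_cycle.edges_nodup, Walk.length_edges]
    simp
  have hle : (Finset.univ.image (fun p : Fin (n + 3) => s(p, p + 1))).card ≤ n + 3 := by
    refine Finset.card_image_le.trans ?_
    simp
  have heq := Finset.eq_of_subset_of_card_le hsub (by rw [hcard]; exact hle)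
  constructor
  · have : (Finset.univ.image (fun p : Fin (n + 3) => s(p, p + 1))).card =
        (Finset.univ : Finset (Fin (n + 3))).card := by
      rw [← heq, hcard]; simp
    have := Finset.card_image_iff.1 this
    simpa [Set.injOn_univ] using this
  · intro e
    rw [← List.mem_toFinset, heq, Finset.mem_image]
    simp

theorem tour_exists (n : ℕ) (σ : Fin (n + 3) ≃ Fin (n + 3)) :
    ∃ x ∈ tspPolytope (n + 3), ∀ S : Finset (Fin (n + 3)), cutSum S x =
      ((Finset.univ.filter (fun p : Fin (n + 3) => ¬ (σ p ∈ S ↔ σ (p + 1) ∈ S))).card : ℝ) := by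
  obtain ⟨hinj, hmem⟩ := cycle_edges n
  let f : cycleGraph (n + 3) →g (⊤ : SimpleGraph (Fin (n + 3))) :=
    ⟨σ, fun {a b} h => by simpa using h.ne⟩
  have hf : Function.Bijective f := σ.bijective
  let C := (cycleGraph.cycle n).map f
  have hC : C.IsHamiltonianCycle := by
    rw [Walk.isHamiltonianCycle_iff_isCycle_and_length_eq]
    refine ⟨cycleGraph.isCycle_cycle.map hf.injective, ?_⟩
    simp [C]
  have hCe : ∀ e, e ∈ C.edges ↔ ∃ p : Fin (n + 3), s(σ p, σ (p + 1)) = e := by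
    intro e
    simp only [C, Walk.edges_map, List.mem_map, hmem]
    constructor
    · rintro ⟨_, ⟨p, rfl⟩, rfl⟩
      exact ⟨p, rfl⟩
    · rintro ⟨p, rfl⟩
      exact ⟨_, ⟨p, rfl⟩, rfl⟩
  refine ⟨fun e => if e.1 ∈ C.edges then (1 : ℝ) else 0, subset_convexHull ℝ _ ⟨_, C, hC, rfl⟩, ?_⟩
  intro S
  have hne : ∀ p : Fin (n + 3), ¬ (s(σ p, σ (p + 1))).IsDiag := by
    intro p h
    rw [Sym2.mk_isDiag_iff] at h
    have := σ.injective h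
    simp at this
  let em : Fin (n + 3) → KEdge (n + 3) := fun p => ⟨s(σ p, σ (p + 1)), hne p⟩
  have hem : Function.Injective em := by
    intro p q h
    have h1 : Sym2.map σ s(p, p + 1) = Sym2.map σ s(q, q + 1) := congrArg Subtype.val h
    exact hinj (Sym2.map.injective σ.injective h1)
  unfold cutSum
  rw [← Finset.sum_filter, Finset.sum_const, nsmul_eq_mul, mul_one]
  congr 1
  have hcr : ∀ p, crossing S (em p).1 ↔ ¬ (σ p ∈ S ↔ σ (p + 1) ∈ S) := by
    intro p
    simp only [crossing, em, Sym2.mem_iff]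
    constructor
    · rintro ⟨⟨a, ha, haS⟩, ⟨b, hb, hbS⟩⟩ h
      rcases ha with rfl | rfl <;> rcases hb with rfl | rfl <;> tauto
    · intro h
      by_cases h1 : σ p ∈ S
      · exact ⟨⟨_, Or.inl rfl, h1⟩, ⟨_, Or.inr rfl, by tauto⟩⟩
      · exact ⟨⟨_, Or.inr rfl, by tauto⟩, ⟨_, Or.inl rfl, h1⟩⟩
  rw [← Finset.card_map ⟨em, hem⟩]
  congr 1
  ext e
  simp only [Finset.mem_filter, Finset.mem_map, Finset.mem_univ, true_and,
    Function.Embedding.coeFn_mk]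
  constructor
  · rintro ⟨h1, h2⟩
    obtain ⟨p, hp⟩ := (hCe _).1 h2
    have : em p = e := Subtype.ext hp
    subst this
    exact ⟨p, (hcr p).1 h1, rfl⟩
  · rintro ⟨p, hp, rfl⟩
    exact ⟨(hcr p).2 hp, (hCe _).2 ⟨p, rfl⟩⟩

/-! ### Part 5, b: block tours -/

/-- The cyclic successor. -/
def nxt {N : ℕ} (p : Fin N) : Fin N := ⟨(p.val + 1) % N, Nat.mod_lt _ p.pos⟩

theorem tour_exists' (N : ℕ) (hN : 3 ≤ N) (σ : Fin N ≃ Fin N) :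
    ∃ x ∈ tspPolytope N, ∀ S : Finset (Fin N), cutSum S x =
      ((Finset.univ.filter (fun p : Fin N => ¬ (σ p ∈ S ↔ σ (nxt p) ∈ S))).card : ℝ) := by
  obtain ⟨n, rfl⟩ : ∃ n, N = n + 3 := ⟨N - 3, by omega⟩
  obtain ⟨x, hx, h⟩ := tour_exists n σ
  refine ⟨x, hx, fun S => ?_⟩
  rw [h S]
  have : ∀ p : Fin (n + 3), nxt p = p + 1 := fun p => by
    apply Fin.ext
    simp [nxt, Fin.val_add]
  simp only [this]

theorem nxt_prod_lt {K t : ℕ} (j : Fin K) (i : Fin t) (hi : i.val + 1 < t) :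
    nxt (finProdFinEquiv (j, i)) = finProdFinEquiv (j, ⟨i.val + 1, hi⟩) := by
  apply Fin.ext
  simp only [nxt, finProdFinEquiv_apply_val]
  rw [Nat.mod_eq_of_lt]
  · ring
  · have h1 := j.isLt
    have h2 : t * (j.val + 1) ≤ t * K := Nat.mul_le_mul_left t h1
    rw [mul_comm K t]
    rw [mul_add] at h2
    omega

theorem nxt_prod_eq {K t : ℕ} (j : Fin K) (i : Fin t) (hi : i.val + 1 = t) :
    nxt (finProdFinEquiv (j, i)) = finProdFinEquiv (nxt j, ⟨0, i.pos⟩) := by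
  apply Fin.ext
  simp only [nxt, finProdFinEquiv_apply_val]
  have : i.val + t * j.val + 1 = t * (j.val + 1) := by rw [mul_add]; omega
  rw [this, mul_comm K t, Nat.mul_mod_mul_left]
  simp

/-- The tour visiting the blocks in order `w`, alternating direction. -/
def blockTour {K t : ℕ} (w : Equiv.Perm (Fin K)) : Fin (K * t) ≃ Fin (K * t) :=
  finProdFinEquiv.symm.trans (((Equiv.sigmaEquivProd (Fin K) (Fin t)).symm.trans
    ((Equiv.sigmaCongrRight (fun j : Fin K => if j.val % 2 = 0 then Equiv.refl (Fin t)
      else Fin.revPerm)).trans (Equiv.sigmaEquivProd (Fin K) (Fin t)))).trans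
    ((Equiv.prodCongr w (Equiv.refl _)).trans finProdFinEquiv))

theorem blockTour_apply {K t : ℕ} (w : Equiv.Perm (Fin K)) (j : Fin K) (i : Fin t) :
    blockTour w (finProdFinEquiv (j, i)) =
      finProdFinEquiv (w j, if j.val % 2 = 0 then i else i.rev) := by
  simp only [blockTour, Equiv.trans_apply, Equiv.symm_apply_apply]
  split_ifs with h <;> simp [h]

theorem block_count {K t h : ℕ} (hh : 1 ≤ h) (hht : h < t) (w : Equiv.Perm (Fin K))
    (S : Finset (Fin (K * t))) (α β : Fin K → Prop)
    (hS : ∀ (b : Fin K) (i : Fin t), finProdFinEquiv (b, i) ∈ S ↔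
      (i.val < h ∧ α b ∨ h ≤ i.val ∧ β b)) :
    (Finset.univ.filter (fun p : Fin (K * t) =>
      ¬ (blockTour w p ∈ S ↔ blockTour w (nxt p) ∈ S))).card =
    (Finset.univ.filter (fun b : Fin K => ¬ (α b ↔ β b))).card +
    (Finset.univ.filter (fun j : Fin K =>
      ¬ ((j.val % 2 = 0 ∧ β (w j) ∨ j.val % 2 = 1 ∧ α (w j)) ↔
        ((nxt j).val % 2 = 0 ∧ α (w (nxt j)) ∨ (nxt j).val % 2 = 1 ∧ β (w (nxt j)))))).card := by
  have h1 : (Finset.univ.filter (fun p : Fin (K * t) =>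
      ¬ (blockTour w p ∈ S ↔ blockTour w (nxt p) ∈ S))).card =
      (Finset.univ.filter (fun q : Fin K × Fin t =>
      ¬ (blockTour w (finProdFinEquiv q) ∈ S ↔
        blockTour w (nxt (finProdFinEquiv q)) ∈ S))).card := by
    rw [← Finset.card_map finProdFinEquiv.toEmbedding]
    congr 1
    ext p
    simp only [Finset.mem_map_equiv, Finset.mem_filter, Finset.mem_univ, true_and,
      Equiv.apply_symm_apply]
  have hm : ∀ j : Fin K, j.val % 2 = 0 ∨ j.val % 2 = 1 := fun j => by omega
  rw [h1, ← Finset.card_filter_add_card_filter_not (fun q : Fin K × Fin t => q.2.val + 1 < t)]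
  congr 1
  · rw [← Finset.card_map w.symm.toEmbedding]
    symm
    refine Finset.card_bij (fun j _ => (j, if j.val % 2 = 0 then (⟨h - 1, by omega⟩ : Fin t) else
      ⟨t - 1 - h, by omega⟩)) ?_ ?_ ?_
    · intro j hj
      simp only [Finset.mem_map_equiv, Finset.mem_filter, Finset.mem_univ, true_and,
        Equiv.symm_symm] at hj
      simp only [Finset.mem_filter, Finset.mem_univ, true_and]
      rcases hm j with h0 | h0
      · have hlt : h - 1 + 1 < t := by omega
        rw [if_pos h0]
        refine ⟨?_, hlt⟩
        rw [nxt_prod_lt _ _ hlt, blockTour_apply, blockTour_apply, if_pos h0, if_pos h0, hS, hS]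
        simp only
        intro hcon
        apply hj
        have e1 : h - 1 < h := by omega
        have e2 : ¬ (h - 1 + 1 < h) := by omega
        have e3 : h ≤ h - 1 + 1 := by omega
        have e4 : ¬ (h ≤ h - 1) := by omega
        simpa only [e1, e2, e3, e4, true_and, false_and, or_false, false_or] using hcon
      · have hlt : t - 1 - h + 1 < t := by omega
        have h0' : ¬ (j.val % 2 = 0) := by omega
        rw [if_neg h0']
        refine ⟨?_, hlt⟩
        rw [nxt_prod_lt _ _ hlt, blockTour_apply, blockTour_apply, if_neg h0', if_neg h0', hS, hS]
        simp only [Fin.val_rev]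
        intro hcon
        apply hj
        have e1 : ¬ (t - (t - 1 - h + 1) < h) := by omega
        have e2 : (t - (t - 1 - h + 1 + 1) < h) := by omega
        have e3 : ¬ (h ≤ t - (t - 1 - h + 1 + 1)) := by omega
        have e4 : (h ≤ t - (t - 1 - h + 1)) := by omega
        simp only [e1, e2, e3, e4, true_and, false_and, or_false, false_or] at hcon
        exact hcon.symm
    · intro a _ b _ hab
      exact (Prod.ext_iff.1 hab).1
    · rintro ⟨j, i⟩ hq
      simp only [Finset.mem_filter, Finset.mem_univ, true_and] at hq
      obtain ⟨hq, hlt⟩ := hq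
      rw [nxt_prod_lt _ _ hlt, blockTour_apply, blockTour_apply, hS, hS] at hq
      have hi := i.isLt
      rcases hm j with h0 | h0
      · rw [if_pos h0, if_pos h0] at hq
        simp only at hq
        have hih : i.val = h - 1 := by
          by_contra hne
          apply hq
          by_cases hc : i.val < h
          · have e1 : i.val + 1 < h := by omega
            have e2 : ¬ h ≤ i.val := by omega
            have e3 : ¬ h ≤ i.val + 1 := by omega
            simp only [hc, e1, e2, e3]
          · have e1 : ¬ i.val + 1 < h := by omega
            have e2 : h ≤ i.val := by omega
            have e3 : h ≤ i.val + 1 := by omega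
            simp only [hc, e1, e2, e3]
        refine ⟨j, ?_, ?_⟩
        · simp only [Finset.mem_map_equiv, Finset.mem_filter, Finset.mem_univ, true_and,
            Equiv.symm_symm]
          intro hcon
          apply hq
          have e1 : i.val < h := by omega
          have e2 : ¬ (i.val + 1 < h) := by omega
          have e3 : h ≤ i.val + 1 := by omega
          have e4 : ¬ (h ≤ i.val) := by omega
          simpa only [e1, e2, e3, e4, true_and, false_and, or_false, false_or] using hcon
        · rw [if_pos h0]
          exact Prod.ext rfl (Fin.ext hih.symm)
      · have h0' : ¬ (j.val % 2 = 0) := by omega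
        rw [if_neg h0', if_neg h0'] at hq
        simp only [Fin.val_rev] at hq
        have hih : i.val = t - 1 - h := by
          by_contra hne
          apply hq
          by_cases hc : t - (i.val + 1) < h
          · have e1 : t - (i.val + 1 + 1) < h := by omega
            have e2 : ¬ h ≤ t - (i.val + 1) := by omega
            have e3 : ¬ h ≤ t - (i.val + 1 + 1) := by omega
            simp only [hc, e1, e2, e3]
          · have e1 : ¬ t - (i.val + 1 + 1) < h := by omega
            have e2 : h ≤ t - (i.val + 1) := by omega
            have e3 : h ≤ t - (i.val + 1 + 1) := by omega
            simp only [hc, e1, e2, e3]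
        refine ⟨j, ?_, ?_⟩
        · simp only [Finset.mem_map_equiv, Finset.mem_filter, Finset.mem_univ, true_and,
            Equiv.symm_symm]
          intro hcon
          apply hq
          have e1 : ¬ (t - (i.val + 1) < h) := by omega
          have e2 : t - (i.val + 1 + 1) < h := by omega
          have e3 : ¬ h ≤ t - (i.val + 1 + 1) := by omega
          have e4 : h ≤ t - (i.val + 1) := by omega
          simpa only [e1, e2, e3, e4, true_and, false_and, or_false, false_or] using hcon.symm
        · rw [if_neg h0']
          exact Prod.ext rfl (Fin.ext hih.symm)
  · symm
    have key : ∀ (j : Fin K) (i : Fin t), i.val + 1 = t →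
        ((blockTour w (finProdFinEquiv (j, i)) ∈ S ↔
          blockTour w (nxt (finProdFinEquiv (j, i))) ∈ S) ↔
        ((j.val % 2 = 0 ∧ β (w j) ∨ j.val % 2 = 1 ∧ α (w j)) ↔
        ((nxt j).val % 2 = 0 ∧ α (w (nxt j)) ∨ (nxt j).val % 2 = 1 ∧ β (w (nxt j))))) := by
      intro j i hi
      rw [nxt_prod_eq _ _ hi, blockTour_apply, blockTour_apply, hS, hS]
      have a1 : h ≤ i.val := by omega
      have a2 : ¬ i.val < h := by omega
      have a3 : t - (i.val + 1) < h := by omega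
      have a4 : ¬ h ≤ t - (i.val + 1) := by omega
      have a5 : 0 < h := by omega
      have a6 : ¬ h ≤ 0 := by omega
      have a7 : ¬ t - (0 + 1) < h := by omega
      have a8 : h ≤ t - (0 + 1) := by omega
      have n01 : ¬ (0 : ℕ) = 1 := by omega
      have n10 : ¬ (1 : ℕ) = 0 := by omega
      apply iff_congr
      · rcases hm j with e | e
        · simp only [e, if_true, a1, a2, true_and, false_and, false_or, n01, or_false]
        · simp only [e, n10, if_false, Fin.val_rev, a3, a4, true_and, false_and, false_or, or_false]
      · rcases hm (nxt j) with e | e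
        · simp only [e, if_true, a5, a6, true_and, false_and, n01, or_false]
        · simp only [e, n10, if_false, Fin.val_rev, a7, a8, true_and, false_and, false_or]
    refine Finset.card_bij (fun j _ => (j, (⟨t - 1, by omega⟩ : Fin t))) ?_ ?_ ?_
    · intro j hj
      simp only [Finset.mem_filter, Finset.mem_univ, true_and] at hj ⊢
      refine ⟨?_, by omega⟩
      rw [key _ _ (by simp only; omega)]
      exact hj
    · intro a _ b _ hab
      exact (Prod.ext_iff.1 hab).1
    · rintro ⟨j, i⟩ hq
      simp only [Finset.mem_filter, Finset.mem_univ, true_and] at hq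
      have hi := i.isLt
      refine ⟨j, ?_, Prod.ext rfl (Fin.ext (by simp only; omega))⟩
      simp only [Finset.mem_filter, Finset.mem_univ, true_and]
      rw [← key _ i (by omega)]
      exact hq.1

/-! ### Part 5, c: combs and their slack -/

/-- The positions of the free blocks. -/
def freeEquiv (K s : ℕ) (hK : 2 * s + 3 ≤ K) :
    Fin (2 * s) ≃ {j : Fin K // 1 ≤ j.val ∧ j.val ≤ 2 * s} where
  toFun i := ⟨⟨i.val + 1, by omega⟩, by simp only; omega⟩
  invFun j := ⟨j.1.val - 1, by have := j.2; omega⟩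
  left_inv i := by apply Fin.ext; simp
  right_inv j := by
    apply Subtype.ext; apply Fin.ext
    have := j.2
    simp only
    omega

/-- The block order. -/
noncomputable def wperm (K s : ℕ) (hK : 2 * s + 3 ≤ K) (ρ : Equiv.Perm (Fin (2 * s))) :
    Equiv.Perm (Fin K) := ρ.extendDomain (freeEquiv K s hK)

theorem wperm_in (K s : ℕ) (hK : 2 * s + 3 ≤ K) (ρ : Equiv.Perm (Fin (2 * s)))
    (j : Fin K) (i : Fin (2 * s)) (hj : j.val = i.val + 1) :
    (wperm K s hK ρ j).val = (ρ i).val + 1 := by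
  have h := Equiv.Perm.extendDomain_apply_image ρ (freeEquiv K s hK) i
  have e : ((freeEquiv K s hK i : {j : Fin K // 1 ≤ j.val ∧ j.val ≤ 2 * s}) : Fin K) = j :=
    Fin.ext hj.symm
  rw [e] at h
  unfold wperm
  rw [h]
  rfl

theorem wperm_out (K s : ℕ) (hK : 2 * s + 3 ≤ K) (ρ : Equiv.Perm (Fin (2 * s)))
    (j : Fin K) (hj : ¬ (1 ≤ j.val ∧ j.val ≤ 2 * s)) : wperm K s hK ρ j = j :=
  Equiv.Perm.extendDomain_apply_not_subtype ρ (freeEquiv K s hK) hj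

/-- The set of teeth blocks. -/
noncomputable def toothSet (K s : ℕ) (U : Finset (Fin (2 * s))) : Finset (Fin K) :=
  Finset.univ.filter (fun b => b.val = 0 ∨ b.val = 2 * s + 1 ∨ ∃ i ∈ U, b.val = i.val + 1)

theorem mem_toothSet {K s : ℕ} (U : Finset (Fin (2 * s))) (b : Fin K) :
    b ∈ toothSet K s U ↔ (b.val = 0 ∨ b.val = 2 * s + 1 ∨ ∃ i ∈ U, b.val = i.val + 1) := by
  simp [toothSet]

theorem card_toothSet {K s : ℕ} (hK : 2 * s + 3 ≤ K) (U : Finset (Fin (2 * s))) :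
    (toothSet K s U).card = U.card + 2 := by
  let em : Fin (2 * s) ↪ Fin K := ⟨fun i => ⟨i.val + 1, by omega⟩, fun a b h => by
    have := congrArg Fin.val h
    simp only at this
    apply Fin.ext; omega⟩
  have h1 : (⟨2 * s + 1, by omega⟩ : Fin K) ∉ U.map em := by
    intro h
    obtain ⟨i, _, hi⟩ := Finset.mem_map.1 h
    have : i.val + 1 = 2 * s + 1 := congrArg Fin.val hi
    omega
  have h0 : (⟨0, by omega⟩ : Fin K) ∉ insert (⟨2 * s + 1, by omega⟩ : Fin K) (U.map em) := by
    intro h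
    rcases Finset.mem_insert.1 h with h | h
    · have := congrArg Fin.val h
      simp only at this
      omega
    · obtain ⟨i, _, hi⟩ := Finset.mem_map.1 h
      have : i.val + 1 = 0 := congrArg Fin.val hi
      omega
  have : toothSet K s U = insert (⟨0, by omega⟩ : Fin K)
      (insert (⟨2 * s + 1, by omega⟩ : Fin K) (U.map em)) := by
    ext b
    rw [mem_toothSet, Finset.mem_insert, Finset.mem_insert, Finset.mem_map, Fin.ext_iff,
      Fin.ext_iff]
    simp only [Fin.ext_iff]
    have : (∃ i ∈ U, b.val = i.val + 1) ↔ (∃ i ∈ U, i.val + 1 = b.val) :=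
      ⟨fun ⟨i, hi, h⟩ => ⟨i, hi, h.symm⟩, fun ⟨i, hi, h⟩ => ⟨i, hi, h.symm⟩⟩
    rw [this]
    exact Iff.rfl
  rw [this, Finset.card_insert_of_notMem h0, Finset.card_insert_of_notMem h1, Finset.card_map]

/-- The handle. -/
noncomputable def handle (K s h t : ℕ) (U : Finset (Fin (2 * s))) : Finset (Fin (K * t)) :=
  Finset.univ.filter (fun v =>
    ((finProdFinEquiv.symm v).2.val < h ∧
      ((finProdFinEquiv.symm v).1 ∈ toothSet K s U ∨ 2 * s + 2 ≤ (finProdFinEquiv.symm v).1.val)) ∨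
    (h ≤ (finProdFinEquiv.symm v).2.val ∧ 2 * s + 2 ≤ (finProdFinEquiv.symm v).1.val))

/-- A block. -/
noncomputable def blk (K t : ℕ) (b : Fin K) : Finset (Fin (K * t)) :=
  Finset.univ.filter (fun v => (finProdFinEquiv.symm v).1 = b)

theorem mem_handle {K s h t : ℕ} (U : Finset (Fin (2 * s))) (b : Fin K) (i : Fin t) :
    finProdFinEquiv (b, i) ∈ handle K s h t U ↔
      (i.val < h ∧ (b ∈ toothSet K s U ∨ 2 * s + 2 ≤ b.val) ∨ h ≤ i.val ∧ 2 * s + 2 ≤ b.val) := by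
  unfold handle
  rw [Finset.mem_filter]
  simp only [Equiv.symm_apply_apply, Finset.mem_univ, true_and]

theorem mem_blk {K t : ℕ} (b b' : Fin K) (i : Fin t) :
    finProdFinEquiv (b', i) ∈ blk K t b ↔ b' = b := by
  unfold blk
  rw [Finset.mem_filter]
  simp only [Equiv.symm_apply_apply, Finset.mem_univ, true_and]

theorem nxt_val {N : ℕ} (j : Fin N) :
    (j.val + 1 < N ∧ (nxt j).val = j.val + 1) ∨ (j.val + 1 = N ∧ (nxt j).val = 0) := by
  have := j.isLt
  by_cases h : j.val + 1 < N
  · left; exact ⟨h, Nat.mod_eq_of_lt h⟩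
  · right
    have e : j.val + 1 = N := by omega
    refine ⟨e, ?_⟩
    change (j.val + 1) % N = 0
    rw [e]; exact Nat.mod_self N

theorem blk_cut {K t h : ℕ} (hK : 2 ≤ K) (hh : 1 ≤ h) (hht : h < t) (w : Equiv.Perm (Fin K))
    (b : Fin K) :
    (Finset.univ.filter (fun p : Fin (K * t) =>
      ¬ (blockTour w p ∈ blk K t b ↔ blockTour w (nxt p) ∈ blk K t b))).card = 2 := by
  rw [block_count hh hht w (blk K t b) (fun b' => b' = b) (fun b' => b' = b) (fun b' i => by
    rw [mem_blk]
    by_cases hi : i.val < h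
    · have : ¬ h ≤ i.val := by omega
      simp [hi, this]
    · have : h ≤ i.val := by omega
      simp [hi, this])]
  refine (congrArg₂ (· + ·) ?_ ?_ : _ = 0 + 2)
  · rw [Finset.card_eq_zero]
    ext x; simp
  obtain ⟨c, rfl⟩ := w.surjective b
  have hc := c.isLt
  let d : Fin K := ⟨if c.val = 0 then K - 1 else c.val - 1, by split_ifs <;> omega⟩
  have hd : d.val = if c.val = 0 then K - 1 else c.val - 1 := rfl
  have hdc : c ≠ d := by
    intro e
    have := congrArg Fin.val e
    rw [hd] at this
    split_ifs at this <;> omega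
  refine Eq.trans ?_ (Finset.card_pair hdc)
  congr 1
  ext j
  simp only [Finset.mem_filter, Finset.mem_univ, true_and, EmbeddingLike.apply_eq_iff_eq,
    Finset.mem_insert, Finset.mem_singleton]
  have hm : ∀ (j : Fin K) (P : Prop), (j.val % 2 = 0 ∧ P ∨ j.val % 2 = 1 ∧ P) ↔ P := by
    intro j P
    have : j.val % 2 = 0 ∨ j.val % 2 = 1 := by omega
    tauto
  rw [hm, hm]
  simp only [Fin.ext_iff]
  rw [hd]
  have := nxt_val j
  split_ifs <;> omega

theorem handle_cut {K s t h : ℕ} (hK : 2 * s + 3 ≤ K) (hh : 1 ≤ h) (hht : h < t)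
    (ρ F : Equiv.Perm (Fin (2 * s))) (U : Finset (Fin (2 * s)))
    (hF0 : ∀ q q' : Fin (2 * s), q.val % 2 = 0 → q'.val = q.val + 1 →
      F (ρ q) = ρ q' ∧ F (ρ q') = ρ q) :
    (Finset.univ.filter (fun p : Fin (K * t) =>
      ¬ (blockTour (wperm K s hK ρ) p ∈ handle K s h t U ↔
        blockTour (wperm K s hK ρ) (nxt p) ∈ handle K s h t U))).card =
    U.card + 2 + cutN U F := by
  rw [block_count hh hht (wperm K s hK ρ) (handle K s h t U)
    (fun b => b ∈ toothSet K s U ∨ 2 * s + 2 ≤ b.val) (fun b => 2 * s + 2 ≤ b.val)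
    (fun b i => mem_handle U b i)]
  congr 1
  · rw [← card_toothSet hK]
    congr 1
    ext b
    simp only [Finset.mem_filter, Finset.mem_univ, true_and]
    have h1 : b ∈ toothSet K s U → ¬ (2 * s + 2 ≤ b.val) := by
      rw [mem_toothSet]
      rintro (h | h | ⟨i, _, h⟩) <;> omega
    tauto
  · let u : ℕ → Prop := fun p => ∃ hp : p < 2 * s, ρ ⟨p, hp⟩ ∈ U
    have hZ : ∀ j, 2 * s + 2 ≤ (wperm K s hK ρ j).val ↔ 2 * s + 2 ≤ j.val := by
      intro j
      by_cases hj : 1 ≤ j.val ∧ j.val ≤ 2 * s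
      · rw [wperm_in K s hK ρ j ⟨j.val - 1, by omega⟩ (by simp only; omega)]
        have := (ρ ⟨j.val - 1, by omega⟩).isLt
        omega
      · rw [wperm_out K s hK ρ j hj]
    have hT : ∀ j, wperm K s hK ρ j ∈ toothSet K s U ↔
        (j.val = 0 ∨ j.val = 2 * s + 1 ∨ (1 ≤ j.val ∧ u (j.val - 1))) := by
      intro j
      rw [mem_toothSet]
      by_cases hj : 1 ≤ j.val ∧ j.val ≤ 2 * s
      · rw [wperm_in K s hK ρ j ⟨j.val - 1, by omega⟩ (by simp only; omega)]
        have h1 := (ρ ⟨j.val - 1, by omega⟩).isLt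
        constructor
        · rintro (h | h | ⟨i, hi, h⟩)
          · omega
          · omega
          · right; right
            refine ⟨hj.1, by omega, ?_⟩
            have : ρ ⟨j.val - 1, by omega⟩ = i := Fin.ext (by omega)
            rw [this]; exact hi
        · rintro (h | h | ⟨_, ⟨hp, h⟩⟩)
          · omega
          · omega
          · right; right
            exact ⟨_, h, rfl⟩
      · rw [wperm_out K s hK ρ j hj]
        constructor
        · rintro (h | h | ⟨i, hi, h⟩)
          · exact Or.inl h
          · exact Or.inr (Or.inl h)
          · omega
        · rintro (h | h | ⟨_, ⟨hp, h⟩⟩)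
          · exact Or.inl h
          · exact Or.inr (Or.inl h)
          · omega
    simp only [hZ, hT]
    have hlink : ∀ j : Fin K,
        (¬ ((j.val % 2 = 0 ∧ 2 * s + 2 ≤ j.val ∨ j.val % 2 = 1 ∧
          ((j.val = 0 ∨ j.val = 2 * s + 1 ∨ (1 ≤ j.val ∧ u (j.val - 1))) ∨ 2 * s + 2 ≤ j.val)) ↔
        ((nxt j).val % 2 = 0 ∧ (((nxt j).val = 0 ∨ (nxt j).val = 2 * s + 1 ∨
          (1 ≤ (nxt j).val ∧ u ((nxt j).val - 1))) ∨ 2 * s + 2 ≤ (nxt j).val) ∨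
          (nxt j).val % 2 = 1 ∧ 2 * s + 2 ≤ (nxt j).val))) ↔
        (j.val % 2 = 1 ∧ j.val + 1 ≤ 2 * s ∧ ¬ (u (j.val - 1) ↔ u j.val)) := by
      intro j
      rcases nxt_val j with ⟨h1, h2⟩ | ⟨h1, h2⟩
      · rw [h2, Nat.add_sub_cancel]
        rcases Nat.mod_two_eq_zero_or_one j.val with h3 | h3
        · have e1 : (j.val + 1) % 2 = 1 := by omega
          rw [h3, e1]
          constructor
          · intro hc
            exfalso
            apply hc
            constructor
            · rintro (h | h) <;> omega
            · rintro (h | h) <;> omega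
          · rintro ⟨h, _⟩
            omega
        · have e1 : (j.val + 1) % 2 = 0 := by omega
          rw [h3, e1]
          by_cases h4 : j.val + 1 ≤ 2 * s
          · have a1 : ¬ j.val = 0 := by omega
            have a2 : ¬ j.val = 2 * s + 1 := by omega
            have a3 : 1 ≤ j.val := by omega
            have a4 : ¬ 2 * s + 2 ≤ j.val := by omega
            have a5 : ¬ j.val + 1 = 0 := by omega
            have a6 : ¬ j.val + 1 = 2 * s + 1 := by omega
            have a7 : 1 ≤ j.val + 1 := by omega
            have a8 : ¬ 2 * s + 2 ≤ j.val + 1 := by omega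
            have a9 : ¬ j.val = 2 * s := by omega
            simp [a1, a2, a3, a4, a9, a8, h4]
          · have b1 : j.val = 2 * s + 1 ∨ 2 * s + 2 ≤ j.val := by omega
            have b2 : 2 * s + 2 ≤ j.val + 1 := by omega
            constructor
            · intro hc
              exfalso
              apply hc
              refine iff_of_true (Or.inr ⟨rfl, ?_⟩) (Or.inl ⟨rfl, Or.inr b2⟩)
              rcases b1 with b1 | b1
              · exact Or.inl (Or.inr (Or.inl b1))
              · exact Or.inr b1
            · rintro ⟨_, h, _⟩
              exact absurd h h4
      · rw [h2]
        constructor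
        · intro hc
          exfalso
          apply hc
          refine iff_of_true ?_ (Or.inl ⟨rfl, Or.inl (Or.inl rfl)⟩)
          rcases Nat.mod_two_eq_zero_or_one j.val with h3 | h3
          · exact Or.inl ⟨h3, by omega⟩
          · exact Or.inr ⟨h3, Or.inr (by omega)⟩
        · rintro ⟨_, h, _⟩
          omega
    simp only [hlink]
    unfold cutN
    symm
    -- partner facts
    have hpart : ∀ q : Fin (2 * s), ∃ q' : Fin (2 * s), q'.val / 2 = q.val / 2 ∧ q' ≠ q ∧
        F (ρ q) = ρ q' := by
      intro q
      have hq := q.isLt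
      rcases Nat.mod_two_eq_zero_or_one q.val with h3 | h3
      · refine ⟨⟨q.val + 1, by omega⟩, by simp only; omega, ?_, (hF0 q _ h3 rfl).1⟩
        intro e
        have := congrArg Fin.val e
        simp only at this
        omega
      · refine ⟨⟨q.val - 1, by omega⟩, by simp only; omega, ?_,
          (hF0 ⟨q.val - 1, by omega⟩ q (by simp only; omega) (by simp only; omega)).2⟩
        intro e
        have := congrArg Fin.val e
        simp only at this
        omega
    refine Finset.card_bij (fun x _ => (⟨2 * ((ρ.symm x).val / 2) + 1, by
      have := (ρ.symm x).isLt; omega⟩ : Fin K)) ?_ ?_ ?_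
    · intro x hx
      simp only [Finset.mem_filter, Finset.mem_univ, true_and] at hx ⊢
      obtain ⟨q, rfl⟩ := ρ.surjective x
      rw [Equiv.symm_apply_apply]
      have hq := q.isLt
      refine ⟨by omega, by omega, ?_⟩
      rw [Nat.add_sub_cancel]
      rcases Nat.mod_two_eq_zero_or_one q.val with h3 | h3
      · have e1 : 2 * (q.val / 2) = q.val := by omega
        rw [e1]
        intro hc
        obtain ⟨hp, h⟩ := hc.1 ⟨hq, hx.1⟩
        have := (hF0 q ⟨q.val + 1, hp⟩ h3 rfl).1
        rw [this] at hx
        exact hx.2 h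
      · have e1 : 2 * (q.val / 2) + 1 = q.val := by omega
        rw [e1]
        intro hc
        obtain ⟨hp, h⟩ := hc.2 ⟨hq, hx.1⟩
        have := (hF0 ⟨_, hp⟩ q (by simp only; omega) (by simp only; omega)).2
        rw [this] at hx
        exact hx.2 h
    · intro x hx y hy hxy
      simp only [Finset.mem_filter, Finset.mem_univ, true_and] at hx hy
      obtain ⟨q, rfl⟩ := ρ.surjective x
      obtain ⟨r, rfl⟩ := ρ.surjective y
      have := congrArg Fin.val hxy
      simp only [Equiv.symm_apply_apply] at this
      by_contra hne
      have hqr : q.val ≠ r.val := fun e => hne (by rw [Fin.ext e])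
      obtain ⟨q', h1, h2, h3⟩ := hpart q
      have h2' : q'.val ≠ q.val := fun e => h2 (Fin.ext e)
      have : q' = r := Fin.ext (by omega)
      subst this
      rw [h3] at hx
      exact hx.2 hy.1
    · intro j hj
      simp only [Finset.mem_filter, Finset.mem_univ, true_and] at hj
      obtain ⟨h1, h2, h3⟩ := hj
      have hF := hF0 ⟨j.val - 1, by omega⟩ ⟨j.val, by omega⟩ (by simp only; omega)
        (by simp only; omega)
      by_cases h4 : u (j.val - 1)
      · have h5 : ¬ u j.val := fun h5 => h3 ⟨fun _ => h5, fun _ => h4⟩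
        refine ⟨ρ ⟨j.val - 1, by omega⟩, ?_, ?_⟩
        · simp only [Finset.mem_filter, Finset.mem_univ, true_and]
          refine ⟨h4.2, ?_⟩
          rw [hF.1]
          exact fun h => h5 ⟨_, h⟩
        · apply Fin.ext
          simp only [Equiv.symm_apply_apply]
          omega
      · have h5 : u j.val := by
          by_contra h5
          exact h3 ⟨fun h => absurd h h4, fun h => absurd h h5⟩
        refine ⟨ρ ⟨j.val, by omega⟩, ?_, ?_⟩
        · simp only [Finset.mem_filter, Finset.mem_univ, true_and]
          refine ⟨h5.2, ?_⟩
          rw [hF.2]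
          exact fun h => h4 ⟨_, h⟩
        · apply Fin.ext
          simp only [Equiv.symm_apply_apply]
          omega

/-! ### Part 5, d: the uniform combs, and orderings adapted to a matching -/

theorem card_blk {K t : ℕ} (b : Fin K) : (blk K t b).card = t := by
  have : blk K t b = (Finset.univ : Finset (Fin t)).map
      ⟨fun i => finProdFinEquiv (b, i), fun i j hij => by
        have := finProdFinEquiv.injective hij
        exact (Prod.ext_iff.1 this).2⟩ := by
    ext v
    obtain ⟨⟨b', i⟩, rfl⟩ := finProdFinEquiv.surjective v
    rw [mem_blk, Finset.mem_map]
    constructor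
    · rintro rfl
      exact ⟨i, Finset.mem_univ _, rfl⟩
    · rintro ⟨j, _, hj⟩
      have := finProdFinEquiv.injective hj
      exact (Prod.ext_iff.1 this).1.symm
  rw [this, Finset.card_map]
  simp

/-- The teeth. -/
noncomputable def teeth (K s t : ℕ) (U : Finset (Fin (2 * s))) :
    Fin (toothSet K s U).card → Finset (Fin (K * t)) :=
  fun i => blk K t ((toothSet K s U).equivFin.symm i).1

theorem tooth_not_Z {K s : ℕ} (U : Finset (Fin (2 * s))) (b : Fin K) (hb : b ∈ toothSet K s U) :
    ¬ (2 * s + 2 ≤ b.val) := by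
  rw [mem_toothSet] at hb
  rcases hb with h | h | ⟨i, _, h⟩ <;> omega

theorem comb_uniform {K s t h : ℕ} (hK : 2 * s + 3 ≤ K) (hh : 1 ≤ h) (hht : h < t)
    (U : Finset (Fin (2 * s))) (hU : Odd U.card) :
    IsUniformComb h t (handle K s h t U) (teeth K s t U) := by
  have hcard : ∀ b ∈ toothSet K s U, (handle K s h t U ∩ blk K t b).card = h := by
    intro b hb
    have hb' := tooth_not_Z U b hb
    have : handle K s h t U ∩ blk K t b = (Finset.univ : Finset (Fin h)).map
        ⟨fun i => finProdFinEquiv (b, ⟨i.val, by omega⟩), fun i j hij => by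
          have := finProdFinEquiv.injective hij
          have := congrArg Fin.val (Prod.ext_iff.1 this).2
          exact Fin.ext this⟩ := by
      ext v
      obtain ⟨⟨b', i⟩, rfl⟩ := finProdFinEquiv.surjective v
      rw [Finset.mem_inter, mem_blk, mem_handle, Finset.mem_map]
      constructor
      · rintro ⟨h1, rfl⟩
        have hi : i.val < h := by
          rcases h1 with h1 | h1
          · exact h1.1
          · exact absurd h1.2 hb'
        exact ⟨⟨i.val, hi⟩, Finset.mem_univ _, rfl⟩
      · rintro ⟨j, _, hj⟩
        have hj' := finProdFinEquiv.injective hj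
        have e1 : b = b' := (Prod.ext_iff.1 hj').1
        have e2 : j.val = i.val := congrArg Fin.val (Prod.ext_iff.1 hj').2
        subst e1
        refine ⟨Or.inl ⟨?_, Or.inl hb⟩, rfl⟩
        have := j.isLt
        omega
    rw [this, Finset.card_map]
    simp
  refine ⟨⟨?_, ?_, ?_, ?_, ?_⟩, fun i => ⟨card_blk _, hcard _ (Subtype.prop _)⟩⟩
  · rw [card_toothSet hK]
    have := hU.pos
    omega
  · rw [card_toothSet hK]
    exact hU.add_even (by norm_num)
  · intro i j hij
    rw [Finset.disjoint_left]
    intro v h1 h2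
    obtain ⟨⟨b', l⟩, rfl⟩ := finProdFinEquiv.surjective v
    unfold teeth at h1 h2
    rw [mem_blk] at h1 h2
    apply hij
    apply (toothSet K s U).equivFin.symm.injective
    apply Subtype.ext
    rw [← h1, ← h2]
  · intro i
    rw [← Finset.card_pos]
    have := hcard _ (((toothSet K s U).equivFin.symm i).2)
    unfold teeth
    omega
  · refine ⟨finProdFinEquiv ((⟨2 * s + 2, by omega⟩ : Fin K), (⟨0, by omega⟩ : Fin t)), ?_⟩
    rw [Finset.mem_sdiff, mem_handle]
    refine ⟨Or.inl ⟨by simp only; omega, Or.inr le_rfl⟩, ?_⟩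
    intro hmem
    rw [Finset.mem_biUnion] at hmem
    obtain ⟨i, _, hi⟩ := hmem
    unfold teeth at hi
    rw [mem_blk] at hi
    apply tooth_not_Z U _ (((toothSet K s U).equivFin.symm i).2)
    rw [← hi]

theorem fpf_cycleType {α : Type*} [Fintype α] [DecidableEq α] (f : Equiv.Perm α)
    (h1 : Function.Involutive f) (h2 : ∀ x, f x ≠ x) :
    f.cycleType = Multiset.replicate (Fintype.card α / 2) 2 := by
  have hp : f ^ 2 = 1 := by
    ext x; rw [pow_two, Equiv.Perm.mul_apply, h1 x]; rfl
  have h : f.cycleType = Multiset.replicate (Multiset.card f.cycleType) 2 := by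
    refine Multiset.eq_replicate_card.2 fun n hn => ?_
    have hd : n ∣ orderOf f := Equiv.Perm.dvd_of_mem_cycleType hn
    have hd2 : n ∣ 2 := hd.trans (orderOf_dvd_of_pow_eq_one hp)
    have := Equiv.Perm.two_le_of_mem_cycleType hn
    have := Nat.le_of_dvd (by norm_num) hd2
    omega
  have hs := Equiv.Perm.sum_cycleType f
  have hsupp : f.support = Finset.univ := by
    ext x; simp [h2 x]
  rw [hsupp, Finset.card_univ, h, Multiset.sum_replicate, smul_eq_mul] at hs
  rw [h, ← hs]
  congr 1
  omega

/-- The standard perfect matching. -/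
def stdMatch (s : ℕ) : Equiv.Perm (Fin (2 * s)) :=
  Function.Involutive.toPerm (fun q => if h : q.val % 2 = 0 then ⟨q.val + 1, by omega⟩
    else ⟨q.val - 1, by omega⟩) (fun q => by
      by_cases h : q.val % 2 = 0
      · have h' : ¬ (q.val + 1) % 2 = 0 := by omega
        simp [h, h']
      · have h' : (q.val - 1) % 2 = 0 := by omega
        apply Fin.ext
        simp only [h, h', dite_true, dite_false]
        omega)

theorem stdMatch_even {s : ℕ} (q q' : Fin (2 * s)) (h : q.val % 2 = 0) (h' : q'.val = q.val + 1) :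
    stdMatch s q = q' := by
  apply Fin.ext
  rw [h']
  change (if h : q.val % 2 = 0 then (⟨q.val + 1, by omega⟩ : Fin (2 * s))
    else ⟨q.val - 1, by omega⟩).val = _
  rw [dif_pos h]

theorem stdMatch_invol (s : ℕ) : Function.Involutive (stdMatch s) :=
  Function.Involutive.toPerm_involutive _

theorem stdMatch_ne {s : ℕ} (q : Fin (2 * s)) : stdMatch s q ≠ q := by
  intro e
  have := congrArg Fin.val e
  change (if h : q.val % 2 = 0 then (⟨q.val + 1, by omega⟩ : Fin (2 * s))
    else ⟨q.val - 1, by omega⟩).val = _ at this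
  split_ifs at this with h
  · simp only at this; omega
  · simp only at this; omega

theorem ordering_exists {s : ℕ} (F : Equiv.Perm (Fin (2 * s))) (h1 : Function.Involutive F)
    (h2 : ∀ x, F x ≠ x) :
    ∃ ρ : Equiv.Perm (Fin (2 * s)), ∀ q q' : Fin (2 * s), q.val % 2 = 0 → q'.val = q.val + 1 →
      F (ρ q) = ρ q' ∧ F (ρ q') = ρ q := by
  have hc : IsConj (stdMatch s) F := by
    rw [Equiv.Perm.isConj_iff_cycleType_eq, fpf_cycleType _ (stdMatch_invol s) stdMatch_ne,
      fpf_cycleType _ h1 h2]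
  obtain ⟨ρ, hρ⟩ := isConj_iff.1 hc
  refine ⟨ρ, fun q q' hq hq' => ?_⟩
  have e : F (ρ q) = ρ q' := by
    rw [← hρ]
    simp [stdMatch_even q q' hq hq']
  exact ⟨e, by rw [← e, h1]⟩

/-- The left-hand side of the comb inequality, as a linear functional. -/
noncomputable def combLin (K s h t : ℕ) (U : Finset (Fin (2 * s))) :
    (KEdge (K * t) → ℝ) →ₗ[ℝ] ℝ where
  toFun x := cutSum (handle K s h t U) x + ∑ i, cutSum (teeth K s t U i) x
  map_add' x y := by
    simp only [cutSum, Pi.add_apply, Finset.sum_add_distrib]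
    ring
  map_smul' r x := by
    simp only [cutSum, Pi.smul_apply, smul_eq_mul, ← Finset.mul_sum, RingHom.id_apply]
    ring

theorem tour_slack {K s t h : ℕ} (hK : 2 * s + 3 ≤ K) (hh : 1 ≤ h) (hht : h < t)
    (F : Equiv.Perm (Fin (2 * s))) (h1 : Function.Involutive F) (h2 : ∀ x, F x ≠ x) :
    ∃ x ∈ tspPolytope (K * t), ∀ U : Finset (Fin (2 * s)),
      combLin K s h t U x = 3 * ((toothSet K s U).card : ℝ) + cutN U F := by
  obtain ⟨ρ, hρ⟩ := ordering_exists F h1 h2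
  have hKt : 3 ≤ K * t := by nlinarith
  obtain ⟨x, hx, hcut⟩ := tour_exists' (K * t) hKt (blockTour (wperm K s hK ρ))
  refine ⟨x, hx, fun U => ?_⟩
  change cutSum (handle K s h t U) x + ∑ i, cutSum (teeth K s t U i) x = _
  rw [hcut, handle_cut hK hh hht ρ F U hρ]
  have : ∀ i, cutSum (teeth K s t U i) x = 2 := fun i => by
    unfold teeth
    rw [hcut, blk_cut (by omega) hh hht]
    norm_num
  simp only [this, Finset.sum_const, Finset.card_univ, Fintype.card_fin, nsmul_eq_mul]
  rw [card_toothSet hK]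
  push_cast
  ring

/-! ### Part 6: assembly -/

theorem cutN_permCongr {V W : Type*} (e : V ≃ W) (U : Finset V) (f : Equiv.Perm V) :
    cutN (U.map e.toEmbedding) (e.permCongr f) = cutN U f := by
  unfold cutN
  symm
  refine Finset.card_bij (fun v _ => e v) ?_ ?_ ?_
  · intro v hv
    simp only [Finset.mem_filter] at hv ⊢
    refine ⟨by simpa using hv.1, ?_⟩
    simpa [Equiv.permCongr_apply, Finset.mem_map_equiv] using hv.2
  · intro a _ b _ hab
    exact e.injective hab
  · intro w hw
    simp only [Finset.mem_filter, Finset.mem_map_equiv, Equiv.permCongr_apply,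
      Equiv.symm_apply_apply] at hw
    exact ⟨e.symm w, by simpa only [Finset.mem_filter] using hw, by simp⟩

theorem core_bound (h t K m : ℕ) (hh : 1 ≤ h) (hht : h < t) (hK : 2 * (3 * m + 5) + 3 ≤ K)
    (Q : Set (KEdge (K * t) → ℝ)) (hQ : IsPolyhedron Q) (hsub : tspPolytope (K * t) ⊆ Q)
    (hcomb : ∀ x ∈ Q, ∀ (H : Finset (Fin (K * t))) (k : ℕ) (T : Fin k → Finset (Fin (K * t))),
          IsUniformComb h t H T →
            (3 * k + 1 : ℝ) ≤ cutSum H x + ∑ i, cutSum (T i) x) :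
    1 ≤ 80 * Real.exp (-((m + 1 : ℝ) / 20000)) * (((xc Q : ℝ) + 1) * (6 * m + 10)) := by
  have hcardV : Fintype.card (Vx m) = 2 * (3 * m + 5) := by
    simp
    omega
  let e : Vx m ≃ Fin (2 * (3 * m + 5)) := Fintype.equivFinOfCardEq hcardV
  have hne : Q.Nonempty := by
    obtain ⟨x, hx, _⟩ := tour_slack hK hh hht (stdMatch (3 * m + 5)) (stdMatch_invol _) stdMatch_ne
    exact ⟨x, hsub hx⟩
  obtain ⟨w, hw, hfac⟩ := yannakakis Q hQ hne
  have hU : ∀ U : Finset (Vx m), ∃ c : Option (Fin (xc Q)) → ℝ, Odd U.card → (∀ l, 0 ≤ c l) ∧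
      ∀ x ∈ Q, combLin K (3 * m + 5) h t (U.map e.toEmbedding) x -
        (3 * ((toothSet K (3 * m + 5) (U.map e.toEmbedding)).card : ℝ) + 1) =
          ∑ l, c l * w l x := by
    intro U
    by_cases hodd : Odd U.card
    · obtain ⟨c, hc, h2⟩ := hfac (combLin K (3 * m + 5) h t (U.map e.toEmbedding))
        (3 * ((toothSet K (3 * m + 5) (U.map e.toEmbedding)).card : ℝ) + 1) (fun x hx =>
          hcomb x hx _ _ _ (comb_uniform hK hh hht _ (by rw [Finset.card_map]; exact hodd)))
      exact ⟨c, fun _ => ⟨hc, h2⟩⟩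
    · exact ⟨0, fun h => absurd h hodd⟩
  choose c hc using hU
  have hf : ∀ f : Equiv.Perm (Vx m), ∃ x, Function.Involutive f → (∀ v, f v ≠ v) →
      x ∈ Q ∧ ∀ U : Finset (Vx m), combLin K (3 * m + 5) h t (U.map e.toEmbedding) x =
        3 * ((toothSet K (3 * m + 5) (U.map e.toEmbedding)).card : ℝ) + cutN U f := by
    intro f
    by_cases hf : Function.Involutive f ∧ (∀ v, f v ≠ v)
    · obtain ⟨x, hx, h1⟩ := tour_slack hK hh hht (e.permCongr f) (fun y => by
        simp [Equiv.permCongr_apply, hf.1 _]) (fun y hy => by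
        rw [Equiv.permCongr_apply] at hy
        apply hf.2 (e.symm y)
        apply e.injective
        rw [hy, Equiv.apply_symm_apply])
      refine ⟨x, fun _ _ => ⟨hsub hx, fun U => ?_⟩⟩
      rw [h1, cutN_permCongr]
    · exact ⟨0, fun h1 h2 => absurd ⟨h1, h2⟩ hf⟩
  choose xf hxf using hf
  have := rank_bound (m := m) (R := Option (Fin (xc Q))) (fun l U => c U l) (fun l f => w l (xf f))
    (fun l U hodd => (hc U hodd).1 l) (fun l f h1 h2 => hw l _ (hxf f h1 h2).1)
    (fun U f hodd h1 h2 => by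
      rw [← (hc U hodd).2 _ (hxf f h1 h2).1, (hxf f h1 h2).2 U]
      ring)
  simpa using this

theorem numeric_bound (K m : ℕ) (X : ℝ) (hK : 10 ^ 14 ≤ K) (hm1 : 6 * m + 13 ≤ K)
    (hm2 : K ≤ 6 * m + 18)
    (h : 1 ≤ 80 * Real.exp (-((m + 1 : ℝ) / 20000)) * ((X + 1) * (6 * m + 10))) :
    (2 : ℝ) ^ ((1 / 10 ^ 6 : ℝ) * K) ≤ X := by
  have hK' : (10 : ℝ) ^ 14 ≤ K := by exact_mod_cast hK
  have hK'' : (100000000000000 : ℝ) ≤ K := by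
    have : (10 : ℝ) ^ 14 = 100000000000000 := by norm_num
    linarith
  have hm1' : 6 * (m : ℝ) + 13 ≤ K := by exact_mod_cast hm1
  have hm2' : (K : ℝ) ≤ 6 * m + 18 := by exact_mod_cast hm2
  have hm0 : (0 : ℝ) ≤ m := Nat.cast_nonneg m
  set y : ℝ := (1 / 10 ^ 6 : ℝ) * K with hy
  have hy0 : 0 ≤ y := by rw [hy]; positivity
  -- 2^y ≤ exp y
  have h2 : (2 : ℝ) ^ y ≤ Real.exp y := by
    rw [Real.rpow_def_of_pos (by norm_num)]
    apply Real.exp_le_exp.2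
    have := Real.log_two_lt_d9
    nlinarith
  have hz : y + (K : ℝ) / 200000 ≤ (m + 1 : ℝ) / 20000 := by
    have e6 : (1 / 10 ^ 6 : ℝ) = 1 / 1000000 := by norm_num
    rw [hy, e6]
    linarith
  have hexp : Real.exp y * Real.exp ((K : ℝ) / 200000) ≤ Real.exp ((m + 1 : ℝ) / 20000) := by
    rw [← Real.exp_add]; exact Real.exp_le_exp.2 hz
  have hq : 160 * (K : ℝ) ≤ Real.exp ((K : ℝ) / 200000) := by
    have h1 := Real.quadratic_le_exp_of_nonneg (x := (K : ℝ) / 200000) (by positivity)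
    have : 160 * (K : ℝ) ≤ ((K : ℝ) / 200000) ^ 2 / 2 := by
      have : ((K : ℝ) / 200000) ^ 2 / 2 = K * (K / (2 * 200000 ^ 2)) := by ring
      rw [this]
      have h3 : (160 : ℝ) ≤ K / (2 * 200000 ^ 2) := by
        rw [le_div_iff₀ (by norm_num)]
        have e7 : (160 : ℝ) * (2 * 200000 ^ 2) ≤ 100000000000000 := by norm_num
        linarith
      nlinarith
    have : 0 ≤ (K : ℝ) / 200000 := by positivity
    linarith
  have hE : 1 ≤ Real.exp y := Real.one_le_exp hy0
  rw [Real.exp_neg] at h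
  set E := Real.exp ((m + 1 : ℝ) / 20000) with hEdef
  have hE0 : 0 < E := Real.exp_pos _
  have h3 : E ≤ 80 * ((X + 1) * (6 * m + 10)) := by
    have : 80 * E⁻¹ * ((X + 1) * (6 * m + 10)) = (80 * ((X + 1) * (6 * m + 10))) / E := by
      field_simp
    rw [this, le_div_iff₀ hE0, one_mul] at h
    exact h
  have hX : 0 ≤ X + 1 := by
    by_contra hcon
    push Not at hcon
    have : 80 * ((X + 1) * (6 * m + 10)) ≤ 0 := by nlinarith
    linarith
  have hKpos : (0 : ℝ) < K := lt_of_lt_of_le (by norm_num) hK'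
  have h4 : Real.exp y * (160 * K) ≤ 80 * ((X + 1) * K) := by
    calc Real.exp y * (160 * K) ≤ Real.exp y * Real.exp ((K : ℝ) / 200000) :=
          mul_le_mul_of_nonneg_left hq (Real.exp_pos _).le
      _ ≤ E := hexp
      _ ≤ 80 * ((X + 1) * (6 * m + 10)) := h3
      _ ≤ 80 * ((X + 1) * K) := by
          have := mul_le_mul_of_nonneg_left (show (6 * (m : ℝ) + 10) ≤ K by linarith) hX
          linarith
  have h5 : (2 * Real.exp y) * K ≤ (X + 1) * K := by linarith
  have h6 := le_of_mul_le_mul_right h5 hKpos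
  linarith

theorem hfree_tsp_xc_uniform_comb (h t : ℕ) (hh : 1 ≤ h) (hht : h < t) :
    ∃ c : ℝ, 0 < c ∧ ∃ N : ℕ, ∀ n : ℕ, t ∣ n → N ≤ n →
      ∀ Q : Set (KEdge n → ℝ), IsPolyhedron Q → tspPolytope n ⊆ Q →
        (∀ x ∈ Q, ∀ (H : Finset (Fin n)) (k : ℕ) (T : Fin k → Finset (Fin n)),
          IsUniformComb h t H T →
            (3 * k + 1 : ℝ) ≤ cutSum H x + ∑ i, cutSum (T i) x) →
        (2 : ℝ) ^ (c * n / t) ≤ (xc Q : ℝ) := by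

  refine ⟨1 / 10 ^ 6, by positivity, 10 ^ 14 * t, fun n hn hN Q hQ hsub hcomb => ?_⟩
  obtain ⟨K, hK⟩ := hn
  rw [mul_comm] at hK
  subst hK
  have ht : 0 < t := by omega
  have hK : 10 ^ 14 ≤ K := Nat.le_of_mul_le_mul_right hN ht
  have ht' : (t : ℝ) ≠ 0 := by exact_mod_cast ht.ne'
  have e : (1 / 10 ^ 6 : ℝ) * ((K * t : ℕ) : ℝ) / t = (1 / 10 ^ 6 : ℝ) * K := by
    push_cast
    field_simp
  rw [e]
  exact numeric_bound K ((K - 13) / 6) (xc Q) hK (by omega) (by omega)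
    (core_bound h t K ((K - 13) / 6) hh hht (by omega) Q hQ hsub hcomb)
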